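/- Set η := max{1, 2−β}/4. There exists a constant C > 0, depending only on T, α, β, K and δ, such that for every classical solution (v,u,θ,w,b) of the planar compressible MHD system on ℝ × [0,T] with (K,δ)-admissible initial data, one has ∫₀^T sup_{x∈ℝ} θ(x,t) dt ≤ C and ∫₀^T ∫_ℝ θ^{β+2η−2} θ_x² / v dx dt ≤ C. -/

import Mathlib

open MeasureTheory Set Filter

noncomputable section

/-- Viscosity function `μ(z) = 1 + α z^(−α)` (here `μ̃₁ = 1`, `μ̃₂ = α`). -/
def visc (α z : ℝ) : ℝ := 1 + α * z ^ (-α)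

/-- Squared Euclidean norm on `ℝ × ℝ` (used for the transverse fields `w, b ∈ ℝ²`). -/
def sq2 (p : ℝ × ℝ) : ℝ := p.1 ^ 2 + p.2 ^ 2

/-- Partial derivative with respect to the first (spatial) variable. -/
def pdx {E : Type*} [NormedAddCommGroup E] [NormedSpace ℝ E]
    (f : ℝ → ℝ → E) (x t : ℝ) : E := deriv (fun y => f y t) x

/-- Partial derivative with respect to the second (time) variable, taken within `[0, T]`
(so it is one-sided at the endpoints). -/
def pdt (T : ℝ) {E : Type*} [NormedAddCommGroup E] [NormedSpace ℝ E]
    (f : ℝ → ℝ → E) (x t : ℝ) : E := derivWithin (fun s => f x s) (Icc 0 T) t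

/-- A classical solution of the planar compressible MHD system (in Lagrangian coordinates,
with all physical constants normalized to `1` and `μ̃₂ = α`) on `ℝ × [0,T]`:
all the derivatives appearing in the equations exist and are continuous, `v, θ > 0`,
the five equations hold pointwise, the solution tends to `(1,0,1,0,0)` as `|x| → ∞`
uniformly in `t ∈ [0,T]`, and `v−1, u, θ−1, b, w` and their first spatial derivatives
are square-integrable in `x` for each `t ∈ [0,T]`. -/
structure IsClassicalSolution (α β T : ℝ) (v u θ : ℝ → ℝ → ℝ)
    (w b : ℝ → ℝ → ℝ × ℝ) : Prop where
  v_pos : ∀ x : ℝ, ∀ t ∈ Icc (0:ℝ) T, 0 < v x t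
  θ_pos : ∀ x : ℝ, ∀ t ∈ Icc (0:ℝ) T, 0 < θ x t
  diff_x : ∀ x : ℝ, ∀ t ∈ Icc (0:ℝ) T,
    DifferentiableAt ℝ (fun y => v y t) x ∧ DifferentiableAt ℝ (fun y => u y t) x ∧
    DifferentiableAt ℝ (fun y => θ y t) x ∧ DifferentiableAt ℝ (fun y => w y t) x ∧
    DifferentiableAt ℝ (fun y => b y t) x
  diff_xx : ∀ x : ℝ, ∀ t ∈ Icc (0:ℝ) T,
    DifferentiableAt ℝ (fun y => pdx u y t) x ∧ DifferentiableAt ℝ (fun y => pdx θ y t) x ∧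
    DifferentiableAt ℝ (fun y => pdx w y t) x ∧ DifferentiableAt ℝ (fun y => pdx b y t) x
  diff_t : ∀ x : ℝ, ∀ t ∈ Icc (0:ℝ) T,
    DifferentiableWithinAt ℝ (fun s => v x s) (Icc 0 T) t ∧
    DifferentiableWithinAt ℝ (fun s => u x s) (Icc 0 T) t ∧
    DifferentiableWithinAt ℝ (fun s => θ x s) (Icc 0 T) t ∧
    DifferentiableWithinAt ℝ (fun s => w x s) (Icc 0 T) t ∧
    DifferentiableWithinAt ℝ (fun s => b x s) (Icc 0 T) t
  cont : ContinuousOn (fun p : ℝ × ℝ =>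
      (v p.1 p.2, u p.1 p.2, θ p.1 p.2, w p.1 p.2, b p.1 p.2)) (univ ×ˢ Icc 0 T)
  cont_dx : ContinuousOn (fun p : ℝ × ℝ =>
      (pdx v p.1 p.2, pdx u p.1 p.2, pdx θ p.1 p.2, pdx w p.1 p.2, pdx b p.1 p.2))
      (univ ×ˢ Icc 0 T)
  cont_dxx : ContinuousOn (fun p : ℝ × ℝ =>
      (pdx (pdx u) p.1 p.2, pdx (pdx θ) p.1 p.2, pdx (pdx w) p.1 p.2, pdx (pdx b) p.1 p.2))
      (univ ×ˢ Icc 0 T)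
  cont_dt : ContinuousOn (fun p : ℝ × ℝ =>
      (pdt T v p.1 p.2, pdt T u p.1 p.2, pdt T θ p.1 p.2, pdt T w p.1 p.2, pdt T b p.1 p.2))
      (univ ×ˢ Icc 0 T)
  eq_mass : ∀ x : ℝ, ∀ t ∈ Icc (0:ℝ) T, pdt T v x t = pdx u x t
  eq_mom : ∀ x : ℝ, ∀ t ∈ Icc (0:ℝ) T,
    pdt T u x t + pdx (fun y s => θ y s / v y s + sq2 (b y s) / 2) x t
      = pdx (fun y s => visc α (v y s) * pdx u y s / v y s) x t
  eq_w : ∀ x : ℝ, ∀ t ∈ Icc (0:ℝ) T,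
    pdt T w x t - pdx b x t = pdx (fun y s => (v y s)⁻¹ • pdx w y s) x t
  eq_b : ∀ x : ℝ, ∀ t ∈ Icc (0:ℝ) T,
    pdt T (fun y s => v y s • b y s) x t - pdx w x t
      = pdx (fun y s => (v y s)⁻¹ • pdx b y s) x t
  eq_temp : ∀ x : ℝ, ∀ t ∈ Icc (0:ℝ) T,
    pdt T θ x t + θ x t / v x t * pdx u x t
      = pdx (fun y s => θ y s ^ β * pdx θ y s / v y s) x t
        + (visc α (v x t) * pdx u x t ^ 2 + sq2 (pdx w x t) + sq2 (pdx b x t)) / v x t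
  farfield : ∀ ε > (0:ℝ), ∃ M : ℝ, ∀ x : ℝ, ∀ t ∈ Icc (0:ℝ) T, M ≤ |x| →
    |v x t - 1| < ε ∧ |u x t| < ε ∧ |θ x t - 1| < ε ∧
    Real.sqrt (sq2 (b x t)) < ε ∧ Real.sqrt (sq2 (w x t)) < ε
  sq_int : ∀ t ∈ Icc (0:ℝ) T,
    Integrable (fun x => (v x t - 1) ^ 2) ∧ Integrable (fun x => (u x t) ^ 2) ∧
    Integrable (fun x => (θ x t - 1) ^ 2) ∧ Integrable (fun x => sq2 (b x t)) ∧
    Integrable (fun x => sq2 (w x t)) ∧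
    Integrable (fun x => (pdx v x t) ^ 2) ∧ Integrable (fun x => (pdx u x t) ^ 2) ∧
    Integrable (fun x => (pdx θ x t) ^ 2) ∧ Integrable (fun x => sq2 (pdx b x t)) ∧
    Integrable (fun x => sq2 (pdx w x t))

/-- The initial data of a solution are `(K, δ)`-admissible: the `H¹`-type norm of
`(v₀−1, u₀, θ₀−1, b₀, w₀)` is at most `K²` and `v₀ ≥ δ`, `θ₀ ≥ δ`. -/
def Admissible (K δ : ℝ) (v u θ : ℝ → ℝ → ℝ) (w b : ℝ → ℝ → ℝ × ℝ) : Prop :=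
  (∫ x : ℝ, ((v x 0 - 1) ^ 2 + (u x 0) ^ 2 + (θ x 0 - 1) ^ 2 + sq2 (b x 0) + sq2 (w x 0)
      + (pdx v x 0) ^ 2 + (pdx u x 0) ^ 2 + (pdx θ x 0) ^ 2
      + sq2 (pdx b x 0) + sq2 (pdx w x 0))) ≤ K ^ 2 ∧
  (∀ x : ℝ, δ ≤ v x 0) ∧ (∀ x : ℝ, δ ≤ θ x 0)

/-- A classical solution of the planar MHD system with `(K, δ)`-admissible data, written in scalar
components, with the time variable extended constantly outside `[0, T]` so that all fields are
continuous on the whole plane. -/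
structure MHDFlow (α β T K δ : ℝ) where
  (v u θ w₁ w₂ b₁ b₂ ux θx w₁x w₂x b₁x b₂x ut θt w₁t w₂t b₁t b₂t : ℝ → ℝ → ℝ)
  v_pos : ∀ x t, 0 < v x t
  θ_pos : ∀ x t, 0 < θ x t
  cont_v : Continuous fun p : ℝ × ℝ => v p.1 p.2
  cont_u : Continuous fun p : ℝ × ℝ => u p.1 p.2
  cont_θ : Continuous fun p : ℝ × ℝ => θ p.1 p.2
  cont_w₁ : Continuous fun p : ℝ × ℝ => w₁ p.1 p.2
  cont_w₂ : Continuous fun p : ℝ × ℝ => w₂ p.1 p.2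
  cont_b₁ : Continuous fun p : ℝ × ℝ => b₁ p.1 p.2
  cont_b₂ : Continuous fun p : ℝ × ℝ => b₂ p.1 p.2
  cont_ux : Continuous fun p : ℝ × ℝ => ux p.1 p.2
  cont_θx : Continuous fun p : ℝ × ℝ => θx p.1 p.2
  cont_w₁x : Continuous fun p : ℝ × ℝ => w₁x p.1 p.2
  cont_w₂x : Continuous fun p : ℝ × ℝ => w₂x p.1 p.2
  cont_b₁x : Continuous fun p : ℝ × ℝ => b₁x p.1 p.2
  cont_b₂x : Continuous fun p : ℝ × ℝ => b₂x p.1 p.2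
  cont_ut : Continuous fun p : ℝ × ℝ => ut p.1 p.2
  cont_θt : Continuous fun p : ℝ × ℝ => θt p.1 p.2
  cont_w₁t : Continuous fun p : ℝ × ℝ => w₁t p.1 p.2
  cont_w₂t : Continuous fun p : ℝ × ℝ => w₂t p.1 p.2
  cont_b₁t : Continuous fun p : ℝ × ℝ => b₁t p.1 p.2
  cont_b₂t : Continuous fun p : ℝ × ℝ => b₂t p.1 p.2
  deriv_u : ∀ x t, HasDerivAt (fun y => u y t) (ux x t) x
  deriv_θ : ∀ x t, HasDerivAt (fun y => θ y t) (θx x t) x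
  deriv_w₁ : ∀ x t, HasDerivAt (fun y => w₁ y t) (w₁x x t) x
  deriv_w₂ : ∀ x t, HasDerivAt (fun y => w₂ y t) (w₂x x t) x
  deriv_b₁ : ∀ x t, HasDerivAt (fun y => b₁ y t) (b₁x x t) x
  deriv_b₂ : ∀ x t, HasDerivAt (fun y => b₂ y t) (b₂x x t) x
  time_v : ∀ x, ∀ t ∈ Ioo 0 T, HasDerivAt (fun s => v x s) (ux x t) t
  time_u : ∀ x, ∀ t ∈ Ioo 0 T, HasDerivAt (fun s => u x s) (ut x t) t
  time_θ : ∀ x, ∀ t ∈ Ioo 0 T, HasDerivAt (fun s => θ x s) (θt x t) t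
  time_w₁ : ∀ x, ∀ t ∈ Ioo 0 T, HasDerivAt (fun s => w₁ x s) (w₁t x t) t
  time_w₂ : ∀ x, ∀ t ∈ Ioo 0 T, HasDerivAt (fun s => w₂ x s) (w₂t x t) t
  time_b₁ : ∀ x, ∀ t ∈ Ioo 0 T, HasDerivAt (fun s => b₁ x s) (b₁t x t) t
  time_b₂ : ∀ x, ∀ t ∈ Ioo 0 T, HasDerivAt (fun s => b₂ x s) (b₂t x t) t
  momentum : ∀ x t, HasDerivAt
    (fun y => visc α (v y t) * ux y t / v y t - (θ y t / v y t + (b₁ y t ^ 2 + b₂ y t ^ 2) / 2))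
    (ut x t) x
  transverse₁ : ∀ x t, HasDerivAt (fun y => (v y t)⁻¹ * w₁x y t) (w₁t x t - b₁x x t) x
  transverse₂ : ∀ x t, HasDerivAt (fun y => (v y t)⁻¹ * w₂x y t) (w₂t x t - b₂x x t) x
  magnetic₁ : ∀ x t, HasDerivAt (fun y => (v y t)⁻¹ * b₁x y t)
    (ux x t * b₁ x t + v x t * b₁t x t - w₁x x t) x
  magnetic₂ : ∀ x t, HasDerivAt (fun y => (v y t)⁻¹ * b₂x y t)
    (ux x t * b₂ x t + v x t * b₂t x t - w₂x x t) x
  temperature : ∀ x t, HasDerivAt (fun y => θ y t ^ β * θx y t / v y t)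
    (θt x t + θ x t / v x t * ux x t - (visc α (v x t) * ux x t ^ 2
      + (w₁x x t ^ 2 + w₂x x t ^ 2) + (b₁x x t ^ 2 + b₂x x t ^ 2)) / v x t) x
  farfield : ∃ M, 0 < M ∧ ∀ x t, M ≤ |x| → |v x t - 1| ≤ 1 / 2 ∧ |u x t| ≤ 1 / 2 ∧
    |θ x t - 1| ≤ 1 / 2 ∧ |w₁ x t| ≤ 1 / 2 ∧ |w₂ x t| ≤ 1 / 2 ∧ |b₁ x t| ≤ 1 / 2 ∧
    |b₂ x t| ≤ 1 / 2
  init_v : ∀ x, δ ≤ v x 0 ∧ v x 0 ≤ 1 + 2 * K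
  init_θ : ∀ x, δ ≤ θ x 0
  init_int : ∀ R > 0, ∫ x in -R..R, ((v x 0 - 1) ^ 2 + u x 0 ^ 2 + (θ x 0 - 1) ^ 2
    + (b₁ x 0 ^ 2 + b₂ x 0 ^ 2) + (w₁ x 0 ^ 2 + w₂ x 0 ^ 2)) ≤ K ^ 2

namespace MHDFlow

variable {α β T K δ : ℝ} (F : MHDFlow α β T K δ) {X : Type*} [TopologicalSpace X] {f g : X → ℝ}

@[fun_prop]
lemma continuous_v (hf : Continuous f) (hg : Continuous g) :
    Continuous fun a => F.v (f a) (g a) := F.cont_v.comp (hf.prodMk hg)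

@[fun_prop]
lemma continuous_u (hf : Continuous f) (hg : Continuous g) :
    Continuous fun a => F.u (f a) (g a) := F.cont_u.comp (hf.prodMk hg)

@[fun_prop]
lemma continuous_θ (hf : Continuous f) (hg : Continuous g) :
    Continuous fun a => F.θ (f a) (g a) := F.cont_θ.comp (hf.prodMk hg)

@[fun_prop]
lemma continuous_w₁ (hf : Continuous f) (hg : Continuous g) :
    Continuous fun a => F.w₁ (f a) (g a) := F.cont_w₁.comp (hf.prodMk hg)

@[fun_prop]
lemma continuous_w₂ (hf : Continuous f) (hg : Continuous g) :
    Continuous fun a => F.w₂ (f a) (g a) := F.cont_w₂.comp (hf.prodMk hg)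

@[fun_prop]
lemma continuous_b₁ (hf : Continuous f) (hg : Continuous g) :
    Continuous fun a => F.b₁ (f a) (g a) := F.cont_b₁.comp (hf.prodMk hg)

@[fun_prop]
lemma continuous_b₂ (hf : Continuous f) (hg : Continuous g) :
    Continuous fun a => F.b₂ (f a) (g a) := F.cont_b₂.comp (hf.prodMk hg)

@[fun_prop]
lemma continuous_ux (hf : Continuous f) (hg : Continuous g) :
    Continuous fun a => F.ux (f a) (g a) := F.cont_ux.comp (hf.prodMk hg)

@[fun_prop]
lemma continuous_θx (hf : Continuous f) (hg : Continuous g) :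
    Continuous fun a => F.θx (f a) (g a) := F.cont_θx.comp (hf.prodMk hg)

@[fun_prop]
lemma continuous_w₁x (hf : Continuous f) (hg : Continuous g) :
    Continuous fun a => F.w₁x (f a) (g a) := F.cont_w₁x.comp (hf.prodMk hg)

@[fun_prop]
lemma continuous_w₂x (hf : Continuous f) (hg : Continuous g) :
    Continuous fun a => F.w₂x (f a) (g a) := F.cont_w₂x.comp (hf.prodMk hg)

@[fun_prop]
lemma continuous_b₁x (hf : Continuous f) (hg : Continuous g) :
    Continuous fun a => F.b₁x (f a) (g a) := F.cont_b₁x.comp (hf.prodMk hg)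

@[fun_prop]
lemma continuous_b₂x (hf : Continuous f) (hg : Continuous g) :
    Continuous fun a => F.b₂x (f a) (g a) := F.cont_b₂x.comp (hf.prodMk hg)

@[fun_prop]
lemma continuous_ut (hf : Continuous f) (hg : Continuous g) :
    Continuous fun a => F.ut (f a) (g a) := F.cont_ut.comp (hf.prodMk hg)

@[fun_prop]
lemma continuous_θt (hf : Continuous f) (hg : Continuous g) :
    Continuous fun a => F.θt (f a) (g a) := F.cont_θt.comp (hf.prodMk hg)

@[fun_prop]
lemma continuous_w₁t (hf : Continuous f) (hg : Continuous g) :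
    Continuous fun a => F.w₁t (f a) (g a) := F.cont_w₁t.comp (hf.prodMk hg)

@[fun_prop]
lemma continuous_w₂t (hf : Continuous f) (hg : Continuous g) :
    Continuous fun a => F.w₂t (f a) (g a) := F.cont_w₂t.comp (hf.prodMk hg)

@[fun_prop]
lemma continuous_b₁t (hf : Continuous f) (hg : Continuous g) :
    Continuous fun a => F.b₁t (f a) (g a) := F.cont_b₁t.comp (hf.prodMk hg)

@[fun_prop]
lemma continuous_b₂t (hf : Continuous f) (hg : Continuous g) :
    Continuous fun a => F.b₂t (f a) (g a) := F.cont_b₂t.comp (hf.prodMk hg)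

@[fun_prop]
lemma continuous_inv_v (hf : Continuous f) (hg : Continuous g) :
    Continuous fun a => (F.v (f a) (g a))⁻¹ :=
  (F.continuous_v hf hg).inv₀ fun _ => (F.v_pos _ _).ne'

@[fun_prop]
lemma continuous_log_v (hf : Continuous f) (hg : Continuous g) :
    Continuous fun a => Real.log (F.v (f a) (g a)) :=
  (F.continuous_v hf hg).log fun _ => (F.v_pos _ _).ne'

@[fun_prop]
lemma continuous_rpow_v (q : ℝ) (hf : Continuous f) (hg : Continuous g) :
    Continuous fun a => F.v (f a) (g a) ^ q :=
  (F.continuous_v hf hg).rpow_const fun _ => Or.inl (F.v_pos _ _).ne'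

@[fun_prop]
lemma continuous_rpow_θ (q : ℝ) (hf : Continuous f) (hg : Continuous g) :
    Continuous fun a => F.θ (f a) (g a) ^ q :=
  (F.continuous_θ hf hg).rpow_const fun _ => Or.inl (F.θ_pos _ _).ne'

@[fun_prop]
lemma continuous_visc (hf : Continuous f) (hg : Continuous g) :
    Continuous fun a => visc α (F.v (f a) (g a)) := by
  unfold visc; fun_prop

/-- The effective stress `μ(v) u_x / v - θ / v - |b|² / 2`. -/
def stress (x t : ℝ) : ℝ :=
  visc α (F.v x t) * F.ux x t / F.v x t
    - (F.θ x t / F.v x t + (F.b₁ x t ^ 2 + F.b₂ x t ^ 2) / 2)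

/-- The energy density with thermal part `H`. -/
def energy (H : ℝ → ℝ) (x t : ℝ) : ℝ :=
  F.u x t ^ 2 / 2 + (F.w₁ x t ^ 2 + F.w₂ x t ^ 2) / 2
    + F.v x t * (F.b₁ x t ^ 2 + F.b₂ x t ^ 2) / 2 + H (F.θ x t)
    + (F.v x t - Real.log (F.v x t) - 1)

/-- The time derivative of `energy H` when `H' = 1 - θ ^ (-p)`. -/
def energyDot (p x t : ℝ) : ℝ :=
  F.u x t * F.ut x t + (F.w₁ x t * F.w₁t x t + F.w₂ x t * F.w₂t x t)
    + (F.v x t * (F.b₁ x t * F.b₁t x t + F.b₂ x t * F.b₂t x t)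
      + F.ux x t * (F.b₁ x t ^ 2 + F.b₂ x t ^ 2) / 2)
    + (1 - F.θ x t ^ (-p)) * F.θt x t + (1 - (F.v x t)⁻¹) * F.ux x t

/-- The dissipation density for the weight `1 - θ ^ (-p)`. -/
def diss (p x t : ℝ) : ℝ :=
  p * (F.θ x t ^ (β - p - 1) * F.θx x t ^ 2 / F.v x t)
    + F.θ x t ^ (-p) * ((visc α (F.v x t) * F.ux x t ^ 2 + (F.w₁x x t ^ 2 + F.w₂x x t ^ 2)
      + (F.b₁x x t ^ 2 + F.b₂x x t ^ 2)) / F.v x t)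

/-- The production term left over by the weight `1 - θ ^ (-p)`. -/
def prod (p x t : ℝ) : ℝ := (F.θ x t ^ (1 - p) - 1) * F.ux x t / F.v x t

/-- The energy flux for the weight `1 - θ ^ (-p)`. -/
def flux (p x t : ℝ) : ℝ :=
  F.u x t * (F.stress x t + 1) + (F.w₁ x t * F.b₁ x t + F.w₂ x t * F.b₂ x t)
    + (F.w₁ x t * ((F.v x t)⁻¹ * F.w₁x x t) + F.w₂ x t * ((F.v x t)⁻¹ * F.w₂x x t))
    + (F.b₁ x t * ((F.v x t)⁻¹ * F.b₁x x t) + F.b₂ x t * ((F.v x t)⁻¹ * F.b₂x x t))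
    + (1 - F.θ x t ^ (-p)) * (F.θ x t ^ β * F.θx x t / F.v x t)

@[fun_prop]
lemma continuous_stress (hf : Continuous f) (hg : Continuous g) :
    Continuous fun a => F.stress (f a) (g a) := by
  simp only [stress, div_eq_mul_inv]; fun_prop

@[fun_prop]
lemma continuous_energyDot (p : ℝ) (hf : Continuous f) (hg : Continuous g) :
    Continuous fun a => F.energyDot p (f a) (g a) := by
  simp only [energyDot, div_eq_mul_inv]; fun_prop

@[fun_prop]
lemma continuous_diss (p : ℝ) (hf : Continuous f) (hg : Continuous g) :
    Continuous fun a => F.diss p (f a) (g a) := by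
  simp only [diss, div_eq_mul_inv]; fun_prop

@[fun_prop]
lemma continuous_prod (p : ℝ) (hf : Continuous f) (hg : Continuous g) :
    Continuous fun a => F.prod p (f a) (g a) := by
  simp only [prod, div_eq_mul_inv]; fun_prop

@[fun_prop]
lemma continuous_flux (p : ℝ) (hf : Continuous f) (hg : Continuous g) :
    Continuous fun a => F.flux p (f a) (g a) := by
  simp only [flux, div_eq_mul_inv]; fun_prop

lemma diss_nonneg (hα : 0 ≤ α) {p : ℝ} (hp : 0 ≤ p) (x t : ℝ) : 0 ≤ F.diss p x t := by
  have hv := F.v_pos x t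
  have hθ := F.θ_pos x t
  have : 0 ≤ visc α (F.v x t) := by unfold visc; positivity
  unfold diss; positivity

lemma hasDerivAt_energy {H : ℝ → ℝ} {p : ℝ}
    (hH : ∀ z, 0 < z → HasDerivAt H (1 - z ^ (-p)) z) (x : ℝ) {t : ℝ} (ht : t ∈ Ioo 0 T) :
    HasDerivAt (fun s => F.energy H x s) (F.energyDot p x t) t := by
  have hv := F.time_v x t ht
  have h := (((((F.time_u x t ht).pow 2).div_const 2).add
    ((((F.time_w₁ x t ht).pow 2).add ((F.time_w₂ x t ht).pow 2)).div_const 2)).add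
    ((hv.mul (((F.time_b₁ x t ht).pow 2).add ((F.time_b₂ x t ht).pow 2))).div_const 2)).add
    ((hH _ (F.θ_pos x t)).comp t (F.time_θ x t ht)) |>.add
    ((hv.sub (hv.log (F.v_pos x t).ne')).sub_const 1)
  refine h.congr_deriv ?_
  have := (F.v_pos x t).ne'
  simp only [energyDot, Pi.add_apply, Pi.pow_apply]
  field_simp
  ring

lemma hasDerivAt_flux (p x t : ℝ) :
    HasDerivAt (fun y => F.flux p y t)
      (F.energyDot p x t + F.diss p x t - F.prod p x t) x := by
  have hθ := F.θ_pos x t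
  have h := ((((F.deriv_u x t).mul ((F.momentum x t).add_const 1)).add
    (((F.deriv_w₁ x t).mul (F.deriv_b₁ x t)).add ((F.deriv_w₂ x t).mul (F.deriv_b₂ x t)))).add
    (((F.deriv_w₁ x t).mul (F.transverse₁ x t)).add
      ((F.deriv_w₂ x t).mul (F.transverse₂ x t)))).add
    (((F.deriv_b₁ x t).mul (F.magnetic₁ x t)).add ((F.deriv_b₂ x t).mul (F.magnetic₂ x t))) |>.add
    ((((F.deriv_θ x t).rpow_const (p := -p) (Or.inl hθ.ne')).const_sub 1).mul (F.temperature x t))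
  refine h.congr_deriv ?_
  have := (F.v_pos x t).ne'
  have e₁ : F.θ x t ^ (-p - 1) * F.θ x t ^ β = F.θ x t ^ (β - p - 1) := by
    rw [← Real.rpow_add hθ]; ring_nf
  have e₂ : F.θ x t ^ (1 - p) = F.θ x t * F.θ x t ^ (-p) := by
    rw [sub_eq_add_neg, Real.rpow_add hθ, Real.rpow_one]
  simp only [energyDot, diss, prod, ← e₁, e₂]
  field_simp
  ring

end MHDFlow

lemma intervalIntegral_swap_of_continuous {f : ℝ → ℝ → ℝ}
    (hf : Continuous fun q : ℝ × ℝ => f q.1 q.2) (a b c d : ℝ) :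
    ∫ x in a..b, ∫ t in c..d, f x t = ∫ t in c..d, ∫ x in a..b, f x t := by
  refine intervalIntegral_intervalIntegral_swap ?_
  exact ((hf.continuousOn.integrableOn_compact (isCompact_uIcc.prod isCompact_uIcc))).mono_set
    (prod_mono uIoc_subset_uIcc uIoc_subset_uIcc)

lemma sub_eq_integral_of_time_deriv {T t : ℝ} (ht : t ∈ Icc 0 T) {f f' : ℝ → ℝ}
    (hf : Continuous f) (hf' : Continuous f') (h : ∀ s ∈ Ioo 0 T, HasDerivAt f (f' s) s) :
    ∫ s in (0 : ℝ)..t, f' s = f t - f 0 :=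
  intervalIntegral.integral_eq_sub_of_hasDerivAt_of_le ht.1 hf.continuousOn
    (fun s hs => h s ⟨hs.1, hs.2.trans_le ht.2⟩) (hf'.intervalIntegrable _ _)

lemma exists_rpow_bounds (q : ℝ) :
    ∃ m > 0, ∃ M > 0, ∀ z : ℝ, |z - 1| ≤ 1 / 2 → m ≤ z ^ q ∧ z ^ q ≤ M := by
  have hc : ContinuousOn (fun z : ℝ => z ^ q) (Icc (1 / 2) (3 / 2)) :=
    continuousOn_id.rpow_const fun z hz => Or.inl (by simp only [id]; linarith [hz.1])
  have hne : (Icc (1 / 2 : ℝ) (3 / 2)).Nonempty := ⟨1, by norm_num, by norm_num⟩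
  obtain ⟨a, ha, hmin⟩ := isCompact_Icc.exists_isMinOn hne hc
  obtain ⟨b, hb, hmax⟩ := isCompact_Icc.exists_isMaxOn hne hc
  refine ⟨a ^ q, Real.rpow_pos_of_pos (by linarith [ha.1]) _, b ^ q,
    Real.rpow_pos_of_pos (by linarith [hb.1]) _, fun z hz => ?_⟩
  have hz' : z ∈ Icc (1 / 2 : ℝ) (3 / 2) := by
    rw [abs_le] at hz; constructor <;> linarith [hz.1, hz.2]
  exact ⟨hmin hz', hmax hz'⟩

lemma two_mul_le_of_abs_le {χ e A c g : ℝ} (hc : 0 < c) :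
    2 * (χ * |e|) * (A * |g|) ≤ c / 2 * (χ ^ 2 * g ^ 2) + 2 * A ^ 2 / c * e ^ 2 := by
  have h : c / 2 * (χ ^ 2 * g ^ 2) + 2 * A ^ 2 / c * e ^ 2 - 2 * (χ * |e|) * (A * |g|)
      = (c * (χ * |g|) - 2 * A * |e|) ^ 2 / (2 * c) := by
    rw [← sq_abs g, ← sq_abs e]; field_simp; ring
  have : 0 ≤ (c * (χ * |g|) - 2 * A * |e|) ^ 2 / (2 * c) := by positivity
  linarith

namespace MHDFlow

/-- The a priori bounds valid near spatial infinity. -/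
def IsFar {α β T K δ : ℝ} (F : MHDFlow α β T K δ) (x t : ℝ) : Prop :=
  |F.v x t - 1| ≤ 1 / 2 ∧ |F.u x t| ≤ 1 / 2 ∧ |F.θ x t - 1| ≤ 1 / 2 ∧ |F.w₁ x t| ≤ 1 / 2 ∧
    |F.w₂ x t| ≤ 1 / 2 ∧ |F.b₁ x t| ≤ 1 / 2 ∧ |F.b₂ x t| ≤ 1 / 2

/-- The sum of the absolute values of the spatial derivatives. -/
def gradSum {α β T K δ : ℝ} (F : MHDFlow α β T K δ) (x t : ℝ) : ℝ :=
  |F.ux x t| + |F.θx x t| + |F.w₁x x t| + |F.w₂x x t| + |F.b₁x x t| + |F.b₂x x t|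

/-- The sum of the squares of the spatial derivatives. -/
def gradSq {α β T K δ : ℝ} (F : MHDFlow α β T K δ) (x t : ℝ) : ℝ :=
  F.ux x t ^ 2 + F.θx x t ^ 2 + F.w₁x x t ^ 2 + F.w₂x x t ^ 2 + F.b₁x x t ^ 2 + F.b₂x x t ^ 2

lemma exists_flux_le_of_isFar {α : ℝ} (β p : ℝ) (hα : 0 ≤ α) :
    ∃ A > 0, ∀ {T K δ : ℝ} (F : MHDFlow α β T K δ) (x t : ℝ), F.IsFar x t →
      |F.flux p x t| ≤ A * (1 + F.gradSum x t) := by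
  obtain ⟨_, _, V, hV, hVb⟩ := exists_rpow_bounds (-α)
  obtain ⟨_, _, Q, hQ, hQb⟩ := exists_rpow_bounds (-p)
  obtain ⟨_, _, B, hB, hBb⟩ := exists_rpow_bounds β
  refine ⟨6 + (1 + α * V) + (1 + Q) * (2 * B), by positivity,
    fun F x t ⟨hv, hu, hθ, hw₁, hw₂, hb₁, hb₂⟩ => ?_⟩
  have hv0 := F.v_pos x t
  have hθ0 := F.θ_pos x t
  have hv' := abs_le.1 hv
  have hθ' := abs_le.1 hθ
  have hvi : |(F.v x t)⁻¹| ≤ 2 := by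
    rw [abs_of_pos (by positivity)]
    exact inv_le_of_inv_le₀ (by norm_num) (by linarith)
  have hprod {a b A B : ℝ} (ha : |a| ≤ A) (hb : |b| ≤ B) : |a * b| ≤ A * B := by
    rw [abs_mul]; exact mul_le_mul ha hb (abs_nonneg _) ((abs_nonneg _).trans ha)
  have hvisc : |visc α (F.v x t)| ≤ 1 + α * V := by
    have := mul_le_mul_of_nonneg_left (hVb _ hv).2 hα
    unfold visc
    rw [abs_of_pos (by positivity)]
    linarith
  have hθp : |1 - F.θ x t ^ (-p)| ≤ 1 + Q := by
    have h1 := (hQb _ hθ).2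
    have h2 := Real.rpow_pos_of_pos hθ0 (-p)
    rw [abs_le]; constructor <;> linarith
  have hθβ : |F.θ x t ^ β| ≤ B := by
    rw [abs_of_pos (by positivity)]; exact (hBb _ hθ).2
  have hθa : |F.θ x t| ≤ 3 / 2 := by rw [abs_of_pos hθ0]; linarith
  have hpr : |F.θ x t * (F.v x t)⁻¹| ≤ 3 / 2 * 2 := hprod hθa hvi
  have t1 : |F.u x t * (visc α (F.v x t) * F.ux x t * (F.v x t)⁻¹)|
      ≤ 1 / 2 * ((1 + α * V) * |F.ux x t| * 2) :=
    hprod hu (hprod (hprod hvisc le_rfl) hvi)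
  have t2 : |F.u x t * (1 - F.θ x t * (F.v x t)⁻¹ - (F.b₁ x t * F.b₁ x t + F.b₂ x t * F.b₂ x t) / 2)|
      ≤ 1 / 2 * 5 := by
    refine hprod hu ?_
    have := abs_le.1 hpr
    have := abs_le.1 (hprod hb₁ hb₁)
    have := abs_le.1 (hprod hb₂ hb₂)
    rw [abs_le]; constructor <;> linarith
  have t3 := hprod hw₁ hb₁
  have t4 := hprod hw₂ hb₂
  have t5 := hprod hw₁ (hprod hvi (le_refl |F.w₁x x t|))
  have t6 := hprod hw₂ (hprod hvi (le_refl |F.w₂x x t|))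
  have t7 := hprod hb₁ (hprod hvi (le_refl |F.b₁x x t|))
  have t8 := hprod hb₂ (hprod hvi (le_refl |F.b₂x x t|))
  have t9 : |(1 - F.θ x t ^ (-p)) * (F.θ x t ^ β * F.θx x t * (F.v x t)⁻¹)|
      ≤ (1 + Q) * (B * |F.θx x t| * 2) :=
    hprod hθp (hprod (hprod hθβ le_rfl) hvi)
  have hflux : F.flux p x t =
      F.u x t * (visc α (F.v x t) * F.ux x t * (F.v x t)⁻¹)
      + F.u x t * (1 - F.θ x t * (F.v x t)⁻¹ - (F.b₁ x t * F.b₁ x t + F.b₂ x t * F.b₂ x t) / 2)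
      + F.w₁ x t * F.b₁ x t + F.w₂ x t * F.b₂ x t
      + F.w₁ x t * ((F.v x t)⁻¹ * F.w₁x x t) + F.w₂ x t * ((F.v x t)⁻¹ * F.w₂x x t)
      + F.b₁ x t * ((F.v x t)⁻¹ * F.b₁x x t) + F.b₂ x t * ((F.v x t)⁻¹ * F.b₂x x t)
      + (1 - F.θ x t ^ (-p)) * (F.θ x t ^ β * F.θx x t * (F.v x t)⁻¹) := by
    simp only [flux, stress]; ring
  have hsum : |F.flux p x t| ≤ (1 + α * V) * |F.ux x t| + 3 + |F.w₁x x t| + |F.w₂x x t|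
      + |F.b₁x x t| + |F.b₂x x t| + (1 + Q) * (2 * B) * |F.θx x t| := by
    rw [hflux]
    rw [abs_le] at t1 t2 t3 t4 t5 t6 t7 t8 t9 ⊢
    constructor <;> linarith [t1.1, t2.1, t3.1, t4.1, t5.1, t6.1, t7.1, t8.1, t9.1, t1.2, t2.2,
      t3.2, t4.2, t5.2, t6.2, t7.2, t8.2, t9.2]
  refine hsum.trans ?_
  have a1 := abs_nonneg (F.ux x t)
  have a2 := abs_nonneg (F.θx x t)
  have a3 := abs_nonneg (F.w₁x x t)
  have a4 := abs_nonneg (F.w₂x x t)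
  have a5 := abs_nonneg (F.b₁x x t)
  have a6 := abs_nonneg (F.b₂x x t)
  have hP : 0 ≤ 1 + α * V := by positivity
  have hR : 0 ≤ (1 + Q) * (2 * B) := by positivity
  unfold gradSum
  generalize 1 + α * V = P at *
  generalize (1 + Q) * (2 * B) = R at *
  have := mul_nonneg hP a2
  have := mul_nonneg hP (add_nonneg (add_nonneg a3 a4) (add_nonneg a5 a6))
  have := mul_nonneg hR (add_nonneg (add_nonneg a3 a4) (add_nonneg a5 a6))
  have := mul_nonneg hR a1
  linarith

lemma exists_le_diss_of_isFar {α p : ℝ} (β : ℝ) (hα : 0 ≤ α) (hp : 0 < p) :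
    ∃ c > 0, ∀ {T K δ : ℝ} (F : MHDFlow α β T K δ) (x t : ℝ), F.IsFar x t →
      c * F.gradSq x t ≤ F.diss p x t := by
  obtain ⟨m, hm, _, _, hmb⟩ := exists_rpow_bounds (β - p - 1)
  obtain ⟨n, hn, _, _, hnb⟩ := exists_rpow_bounds (-p)
  refine ⟨min (p * m / 2) (n / 2), by positivity, fun F x t ⟨hv, _, hθ, _⟩ => ?_⟩
  have hv0 := F.v_pos x t
  have hvi : 1 / 2 ≤ (F.v x t)⁻¹ := by
    rw [one_div]; exact inv_anti₀ hv0 (by linarith [(abs_le.1 hv).2])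
  have h1 : p * m / 2 * F.θx x t ^ 2
      ≤ p * (F.θ x t ^ (β - p - 1) * F.θx x t ^ 2 / F.v x t) := by
    have := mul_le_mul (hmb _ hθ).1 hvi (by norm_num) (hm.le.trans (hmb _ hθ).1)
    have := mul_le_mul_of_nonneg_left this (mul_nonneg hp.le (sq_nonneg (F.θx x t)))
    simp only [div_eq_mul_inv] at this ⊢
    linarith
  have hvisc : 1 ≤ visc α (F.v x t) := by
    unfold visc
    have : 0 ≤ α * F.v x t ^ (-α) := by positivity
    linarith
  have hS : F.ux x t ^ 2 + (F.w₁x x t ^ 2 + F.w₂x x t ^ 2) + (F.b₁x x t ^ 2 + F.b₂x x t ^ 2)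
      ≤ visc α (F.v x t) * F.ux x t ^ 2 + (F.w₁x x t ^ 2 + F.w₂x x t ^ 2)
        + (F.b₁x x t ^ 2 + F.b₂x x t ^ 2) := by
    have := mul_le_mul_of_nonneg_right hvisc (sq_nonneg (F.ux x t))
    linarith
  have h2 : n / 2 * (F.ux x t ^ 2 + (F.w₁x x t ^ 2 + F.w₂x x t ^ 2)
        + (F.b₁x x t ^ 2 + F.b₂x x t ^ 2))
      ≤ F.θ x t ^ (-p) * ((visc α (F.v x t) * F.ux x t ^ 2 + (F.w₁x x t ^ 2 + F.w₂x x t ^ 2)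
        + (F.b₁x x t ^ 2 + F.b₂x x t ^ 2)) / F.v x t) := by
    have h3 := mul_le_mul (hnb _ hθ).1 hvi (by norm_num) (hn.le.trans (hnb _ hθ).1)
    have := mul_le_mul h3 hS (by positivity)
      (mul_nonneg (hn.le.trans (hnb _ hθ).1) (by positivity))
    simp only [div_eq_mul_inv] at this ⊢
    linarith
  have h4 := mul_le_mul_of_nonneg_right (min_le_left (p * m / 2) (n / 2)) (sq_nonneg (F.θx x t))
  have h5 := mul_le_mul_of_nonneg_right (min_le_right (p * m / 2) (n / 2))
    (show 0 ≤ F.ux x t ^ 2 + (F.w₁x x t ^ 2 + F.w₂x x t ^ 2)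
        + (F.b₁x x t ^ 2 + F.b₂x x t ^ 2) by positivity)
  unfold diss gradSq
  linarith

lemma exists_cutoff_flux_le {α p : ℝ} (β : ℝ) (hα : 0 ≤ α) (hp : 0 < p) :
    ∃ C > 0, ∀ {T K δ : ℝ} (F : MHDFlow α β T K δ) (x t : ℝ), F.IsFar x t →
      ∀ χ e : ℝ, 0 ≤ χ → χ ≤ 1 →
        |2 * (χ * e) * F.flux p x t| ≤ 1 / 2 * (χ ^ 2 * F.diss p x t) + C * (|e| + e ^ 2) := by
  obtain ⟨A, hA, hflux⟩ := exists_flux_le_of_isFar β p hα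
  obtain ⟨c, hc, hdiss⟩ := exists_le_diss_of_isFar β hα hp
  refine ⟨2 * A + 12 * A ^ 2 / c, by positivity, fun F x t hfar χ e h0 h1 => ?_⟩
  have hJ := mul_le_mul_of_nonneg_left (hflux F x t hfar)
    (show 0 ≤ 2 * (χ * |e|) by positivity)
  have hD := mul_le_mul_of_nonneg_left (hdiss F x t hfar) (sq_nonneg χ)
  have q1 := two_mul_le_of_abs_le (χ := χ) (e := e) (A := A) (g := F.ux x t) hc
  have q2 := two_mul_le_of_abs_le (χ := χ) (e := e) (A := A) (g := F.θx x t) hc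
  have q3 := two_mul_le_of_abs_le (χ := χ) (e := e) (A := A) (g := F.w₁x x t) hc
  have q4 := two_mul_le_of_abs_le (χ := χ) (e := e) (A := A) (g := F.w₂x x t) hc
  have q5 := two_mul_le_of_abs_le (χ := χ) (e := e) (A := A) (g := F.b₁x x t) hc
  have q6 := two_mul_le_of_abs_le (χ := χ) (e := e) (A := A) (g := F.b₂x x t) hc
  have q7 : χ * (A * |e|) ≤ 1 * (A * |e|) := mul_le_mul_of_nonneg_right h1 (by positivity)
  have q8 : 0 ≤ 12 * A ^ 2 / c * |e| := by positivity
  have q9 : 0 ≤ 2 * A * e ^ 2 := by positivity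
  have e1 : 12 * A ^ 2 / c = 6 * (2 * A ^ 2 / c) := by ring
  rw [e1] at q8 ⊢
  generalize 2 * A ^ 2 / c = L at *
  have : |2 * (χ * e) * F.flux p x t| = 2 * (χ * |e|) * |F.flux p x t| := by
    rw [abs_mul, abs_mul, abs_mul, abs_of_nonneg h0, abs_two]
  rw [this]
  unfold gradSum at hJ
  unfold gradSq at hD
  nlinarith

end MHDFlow

/-- The parabola `1 - x² / R²`, whose square is used as a cutoff function on `[-R, R]`. -/
def cutoff (R x : ℝ) : ℝ := 1 - x ^ 2 / R ^ 2

lemma hasDerivAt_cutoff (R x : ℝ) : HasDerivAt (cutoff R) (-(2 * x / R ^ 2)) x := by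
  have := (((hasDerivAt_id x).pow 2).div_const (R ^ 2)).const_sub 1
  exact this.congr_deriv (by simp)

@[fun_prop]
lemma continuous_cutoff (R : ℝ) {X : Type*} [TopologicalSpace X] {f : X → ℝ} (hf : Continuous f) :
    Continuous fun a => cutoff R (f a) := by
  simp only [cutoff, div_eq_mul_inv]; fun_prop

lemma cutoff_nonneg {R x : ℝ} (hR : 0 < R) (hx : x ∈ Icc (-R) R) : 0 ≤ cutoff R x := by
  unfold cutoff
  rw [sub_nonneg, div_le_one (by positivity)]
  exact sq_le_sq' hx.1 hx.2

lemma cutoff_le_one (R x : ℝ) : cutoff R x ≤ 1 := by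
  unfold cutoff
  have : 0 ≤ x ^ 2 / R ^ 2 := by positivity
  linarith

lemma abs_deriv_cutoff_le {R x : ℝ} (hR : 0 < R) (hx : x ∈ Icc (-R) R) :
    |-(2 * x / R ^ 2)| ≤ 2 / R := by
  rw [abs_neg, abs_div, abs_mul, abs_two, abs_of_pos (by positivity : 0 < R ^ 2),
    div_le_div_iff₀ (by positivity) hR]
  nlinarith [mul_le_mul_of_nonneg_right (abs_le.2 hx) hR.le]

lemma one_half_le_cutoff_sq {R x : ℝ} (hR : 0 < R) (hx : 2 * |x| ≤ R) :
    1 / 2 ≤ cutoff R x ^ 2 := by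
  have h : x ^ 2 / R ^ 2 ≤ 1 / 4 := by
    rw [div_le_iff₀ (by positivity), ← sq_abs]
    nlinarith [abs_nonneg x]
  unfold cutoff
  nlinarith

lemma intervalIntegral_inv_one_add_sq_le (a b : ℝ) : ∫ x in a..b, (1 + x ^ 2)⁻¹ ≤ Real.pi := by
  rw [integral_inv_one_add_sq]
  linarith [Real.arctan_lt_pi_div_two b, Real.neg_pi_div_two_lt_arctan a]

namespace MHDFlow

variable {α β T K δ : ℝ} (F : MHDFlow α β T K δ)

lemma continuous_energy {H : ℝ → ℝ} {p : ℝ} (hH : ∀ z, 0 < z → HasDerivAt H (1 - z ^ (-p)) z)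
    {X : Type*} [TopologicalSpace X] {f g : X → ℝ} (hf : Continuous f) (hg : Continuous g) :
    Continuous fun a => F.energy H (f a) (g a) := by
  have hH' : ContinuousOn H (Ioi 0) := fun z hz => (hH z hz).continuousAt.continuousWithinAt
  have : Continuous fun a => H (F.θ (f a) (g a)) :=
    hH'.comp_continuous (F.continuous_θ hf hg) fun a => F.θ_pos _ _
  simp only [energy, div_eq_mul_inv]
  refine Continuous.add (Continuous.add ?_ this) ?_ <;> fun_prop

lemma integral_cutoff_energy_sub {H : ℝ → ℝ} {p : ℝ}
    (hH : ∀ z, 0 < z → HasDerivAt H (1 - z ^ (-p)) z) (R : ℝ) {t : ℝ} (ht : t ∈ Icc 0 T) :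
    (∫ x in -R..R, cutoff R x ^ 2 * F.energy H x t)
      - ∫ x in -R..R, cutoff R x ^ 2 * F.energy H x 0
      = ∫ s in (0 : ℝ)..t, ∫ x in -R..R, cutoff R x ^ 2 * F.energyDot p x s := by
  have hc (s : ℝ) : Continuous fun x => cutoff R x ^ 2 * F.energy H x s :=
    (by fun_prop : Continuous fun x => cutoff R x ^ 2).mul
      (F.continuous_energy hH continuous_id continuous_const)
  rw [← intervalIntegral.integral_sub ((hc t).intervalIntegrable _ _)
    ((hc 0).intervalIntegrable _ _), ← intervalIntegral_swap_of_continuous (by fun_prop)]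
  refine intervalIntegral.integral_congr fun x _ => ?_
  simp only [intervalIntegral.integral_const_mul]
  rw [sub_eq_integral_of_time_deriv ht (F.continuous_energy hH continuous_const continuous_id)
    (by fun_prop) fun s hs => F.hasDerivAt_energy hH x hs]
  simp only [id]
  ring

lemma integral_cutoff_energyDot (p : ℝ) {R : ℝ} (hR : 0 < R) (s : ℝ) :
    ∫ x in -R..R, cutoff R x ^ 2 * F.energyDot p x s =
      (∫ x in -R..R, -(2 * (cutoff R x * -(2 * x / R ^ 2)) * F.flux p x s))
        - (∫ x in -R..R, cutoff R x ^ 2 * F.diss p x s)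
        + ∫ x in -R..R, cutoff R x ^ 2 * F.prod p x s := by
  have h0 : cutoff R R = 0 := by simp [cutoff, hR.ne']
  have h1 : cutoff R (-R) = 0 := by simp [cutoff, hR.ne']
  have hparts := intervalIntegral.integral_mul_deriv_eq_deriv_mul (a := -R) (b := R)
    (fun x _ => (hasDerivAt_cutoff R x).pow 2) (fun x _ => F.hasDerivAt_flux p x s)
    (Continuous.intervalIntegrable (by simp only [div_eq_mul_inv]; fun_prop) _ _)
    (Continuous.intervalIntegrable (by fun_prop) _ _)
  simp only [Pi.pow_apply, h0, h1] at hparts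
  have hsplit : ∫ x in -R..R, cutoff R x ^ 2 * (F.energyDot p x s + F.diss p x s - F.prod p x s)
      = (∫ x in -R..R, cutoff R x ^ 2 * F.energyDot p x s)
        + (∫ x in -R..R, cutoff R x ^ 2 * F.diss p x s)
        - ∫ x in -R..R, cutoff R x ^ 2 * F.prod p x s := by
    rw [← intervalIntegral.integral_add, ← intervalIntegral.integral_sub]
    · congr 1; ext x; ring
    all_goals exact Continuous.intervalIntegrable (by fun_prop) _ _
  rw [hsplit] at hparts
  have e : ∫ x in -R..R, -(2 * (cutoff R x * -(2 * x / R ^ 2)) * F.flux p x s)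
      = - ∫ x in -R..R, (2 : ℕ) * cutoff R x ^ (2 - 1) * -(2 * x / R ^ 2) * F.flux p x s := by
    rw [← intervalIntegral.integral_neg]; congr 1; ext x; push_cast; ring
  rw [e]
  linarith

lemma exists_integral_cutoff_energyDot_le {α p : ℝ} (β : ℝ) (hα : 0 ≤ α) (hp : 0 < p) :
    ∃ C > 0, ∀ {T K δ : ℝ} (F : MHDFlow α β T K δ), ∃ R₀ ≥ 1, ∀ R ≥ R₀, ∀ s ∈ Icc 0 T,
      ∫ x in -R..R, cutoff R x ^ 2 * F.energyDot p x s ≤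
        C + (∫ x in -R..R, cutoff R x ^ 2 * F.prod p x s)
          - 1 / 2 * ∫ x in -R..R, cutoff R x ^ 2 * F.diss p x s := by
  obtain ⟨C, hC, hfar⟩ := exists_cutoff_flux_le β hα hp
  refine ⟨12 * C + 1, by positivity, fun {T K δ} F => ?_⟩
  obtain ⟨M, hM, hMfar⟩ := F.farfield
  obtain ⟨B, hB⟩ := ((isCompact_Icc (a := -M) (b := M)).prod
    (isCompact_Icc (a := 0) (b := T))).exists_bound_of_continuousOn
    (f := fun q : ℝ × ℝ => F.flux p q.1 q.2) (by fun_prop)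
  set L : ℝ := 4 * max B 0 * (1 + M ^ 2) with hL
  have hL0 : 0 ≤ L := by positivity
  refine ⟨max 1 (L * Real.pi), le_max_left _ _, fun R hR s hs => ?_⟩
  have hR1 : 1 ≤ R := (le_max_left _ _).trans hR
  have hR0 : 0 < R := by linarith
  have hLR : L * Real.pi ≤ R := (le_max_right _ _).trans hR
  have hpt : ∀ x ∈ Icc (-R) R, -(2 * (cutoff R x * -(2 * x / R ^ 2)) * F.flux p x s) ≤
      1 / 2 * (cutoff R x ^ 2 * F.diss p x s) + 6 * C / R + L / R * (1 + x ^ 2)⁻¹ := by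
    intro x hx
    have hχ := cutoff_nonneg hR0 hx
    have hχ1 := cutoff_le_one R x
    have he := abs_deriv_cutoff_le hR0 hx
    have hD : 0 ≤ 1 / 2 * (cutoff R x ^ 2 * F.diss p x s) := by
      have := F.diss_nonneg hα hp.le x s
      positivity
    refine (neg_le_abs _).trans ?_
    rcases le_total M |x| with hx' | hx'
    · have h1 := hfar F x s (hMfar x s hx') (cutoff R x) (-(2 * x / R ^ 2)) hχ hχ1
      have h2 : |-(2 * x / R ^ 2)| + (-(2 * x / R ^ 2)) ^ 2 ≤ 6 / R := by
        rw [← sq_abs (-(2 * x / R ^ 2))]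
        have h3 : 2 / R * |-(2 * x / R ^ 2)| ≤ 2 / R * 2 := by
          refine mul_le_mul_of_nonneg_left (he.trans ?_) (by positivity)
          rw [div_le_iff₀ hR0]; linarith
        have h4 := mul_le_mul_of_nonneg_right he (abs_nonneg (-(2 * x / R ^ 2)))
        have : 6 / R = 2 / R + 2 / R * 2 := by ring
        rw [this]
        linarith
      have h5 := mul_le_mul_of_nonneg_left h2 hC.le
      have h6 : 0 ≤ L / R * (1 + x ^ 2)⁻¹ := by positivity
      have : 6 * C / R = C * (6 / R) := by ring
      linarith
    · have hJ : |F.flux p x s| ≤ max B 0 :=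
        (hB (x, s) ⟨abs_le.1 hx', hs⟩).trans (le_max_left _ _)
      have h1 : |2 * (cutoff R x * -(2 * x / R ^ 2)) * F.flux p x s| ≤ 4 * max B 0 / R := by
        rw [abs_mul, abs_mul, abs_mul, abs_two, abs_of_nonneg hχ]
        have h2 : cutoff R x * |-(2 * x / R ^ 2)| ≤ 1 * (2 / R) :=
          mul_le_mul hχ1 he (abs_nonneg _) zero_le_one
        have h3 := mul_le_mul (mul_le_mul_of_nonneg_left h2 zero_le_two) hJ (abs_nonneg _)
          (by positivity)
        refine h3.trans (le_of_eq ?_)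
        ring
      have h2 : 4 * max B 0 / R ≤ L / R * (1 + x ^ 2)⁻¹ := by
        rw [hL, ← div_eq_mul_inv, le_div_iff₀ (by positivity), mul_div_right_comm _ (1 + M ^ 2)]
        refine mul_le_mul_of_nonneg_left ?_ (by positivity)
        nlinarith [sq_abs x, abs_nonneg x]
      have h3 : 0 ≤ 6 * C / R := by positivity
      linarith
  have hinv : Continuous fun x : ℝ => (1 + x ^ 2)⁻¹ :=
    (by fun_prop : Continuous fun x : ℝ => 1 + x ^ 2).inv₀ fun x => by positivity
  have hI : ∫ x in -R..R, -(2 * (cutoff R x * -(2 * x / R ^ 2)) * F.flux p x s) ≤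
      ∫ x in -R..R, (1 / 2 * (cutoff R x ^ 2 * F.diss p x s) + 6 * C / R
        + L / R * (1 + x ^ 2)⁻¹) := by
    refine intervalIntegral.integral_mono_on (by linarith)
      (Continuous.intervalIntegrable (by simp only [div_eq_mul_inv]; fun_prop) _ _)
      (Continuous.intervalIntegrable (by fun_prop) _ _) hpt
  rw [intervalIntegral.integral_add (Continuous.intervalIntegrable (by fun_prop) _ _)
      (Continuous.intervalIntegrable (by fun_prop) _ _),
    intervalIntegral.integral_add (Continuous.intervalIntegrable (by fun_prop) _ _)
      (Continuous.intervalIntegrable (by fun_prop) _ _),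
    intervalIntegral.integral_const_mul, intervalIntegral.integral_const_mul,
    intervalIntegral.integral_const, smul_eq_mul] at hI
  have h7 : (R - -R) * (6 * C / R) = 12 * C := by field_simp; ring
  have h8 : L / R * ∫ x in -R..R, (1 + x ^ 2)⁻¹ ≤ 1 := by
    have h9 := mul_le_mul_of_nonneg_left (intervalIntegral_inv_one_add_sq_le (-R) R)
      (show 0 ≤ L / R by positivity)
    refine h9.trans ?_
    rw [div_mul_eq_mul_div, div_le_one hR0]
    exact hLR
  rw [F.integral_cutoff_energyDot p hR0 s]
  linarith

lemma integral_cutoff_energy_zero_le (hK : 0 < K) (hδ : 0 < δ) {H : ℝ → ℝ} {p : ℝ}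
    (hH : ∀ z, 0 < z → HasDerivAt H (1 - z ^ (-p)) z) (hH' : ∀ z, 0 < z → H z ≤ (z - 1) ^ 2 / z)
    {R : ℝ} (hR : 0 < R) (hE : ∀ x, 0 ≤ F.energy H x 0) :
    ∫ x in -R..R, cutoff R x ^ 2 * F.energy H x 0 ≤ (1 + K + 1 / δ) * K ^ 2 := by
  have hpt : ∀ x ∈ Icc (-R) R, cutoff R x ^ 2 * F.energy H x 0 ≤
      (1 + K + 1 / δ) * ((F.v x 0 - 1) ^ 2 + F.u x 0 ^ 2 + (F.θ x 0 - 1) ^ 2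
        + (F.b₁ x 0 ^ 2 + F.b₂ x 0 ^ 2) + (F.w₁ x 0 ^ 2 + F.w₂ x 0 ^ 2)) := by
    intro x hx
    have hχ : cutoff R x ^ 2 ≤ 1 := pow_le_one₀ (cutoff_nonneg hR hx) (cutoff_le_one R x)
    have h1 := mul_le_mul_of_nonneg_right hχ (hE x)
    obtain ⟨hv1, hv2⟩ := F.init_v x
    have hv := F.v_pos x 0
    have hθ := F.θ_pos x 0
    have hdiv {z : ℝ} (hz : δ ≤ z) : (z - 1) ^ 2 / z ≤ 1 / δ * (z - 1) ^ 2 := by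
      rw [div_eq_inv_mul, one_div]
      exact mul_le_mul_of_nonneg_right (inv_anti₀ hδ hz) (sq_nonneg _)
    have h2 : F.v x 0 - Real.log (F.v x 0) - 1 ≤ 1 / δ * (F.v x 0 - 1) ^ 2 := by
      refine le_trans ?_ (hdiv hv1)
      have := Real.one_sub_inv_le_log_of_pos hv
      have e : (F.v x 0 - 1) ^ 2 / F.v x 0 = F.v x 0 - 2 + (F.v x 0)⁻¹ := by field_simp; ring
      linarith
    have h3 : H (F.θ x 0) ≤ 1 / δ * (F.θ x 0 - 1) ^ 2 :=
      (hH' _ hθ).trans (hdiv (F.init_θ x))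
    have h4 := mul_le_mul_of_nonneg_right hv2 (by positivity : 0 ≤ F.b₁ x 0 ^ 2 + F.b₂ x 0 ^ 2)
    have hd : 0 < 1 / δ := by positivity
    generalize 1 / δ = d at *
    have q1 : 0 ≤ (K + d) * F.u x 0 ^ 2 := by positivity
    have q2 : 0 ≤ (K + d) * (F.w₁ x 0 ^ 2 + F.w₂ x 0 ^ 2) := by positivity
    have q3 : 0 ≤ d * (F.b₁ x 0 ^ 2 + F.b₂ x 0 ^ 2) := by positivity
    have q4 : 0 ≤ (1 + K) * (F.v x 0 - 1) ^ 2 := by positivity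
    have q5 : 0 ≤ (1 + K) * (F.θ x 0 - 1) ^ 2 := by positivity
    have q6 : 0 ≤ F.u x 0 ^ 2 := by positivity
    have q7 : 0 ≤ F.w₁ x 0 ^ 2 + F.w₂ x 0 ^ 2 := by positivity
    have q8 : 0 ≤ F.b₁ x 0 ^ 2 + F.b₂ x 0 ^ 2 := by positivity
    refine h1.trans ?_
    unfold energy
    linarith
  have hI := intervalIntegral.integral_mono_on (μ := volume) (by linarith : -R ≤ R)
    (((by fun_prop : Continuous fun x => cutoff R x ^ 2).mul
      (F.continuous_energy hH continuous_id continuous_const)).intervalIntegrable _ _)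
    (Continuous.intervalIntegrable (by fun_prop) _ _) hpt
  rw [intervalIntegral.integral_const_mul] at hI
  exact hI.trans (mul_le_mul_of_nonneg_left (F.init_int R hR) (by positivity))

lemma energy_nonneg {H : ℝ → ℝ} (hH : ∀ z, 0 < z → 0 ≤ H z) (x t : ℝ) : 0 ≤ F.energy H x t := by
  have hv := F.v_pos x t
  have h1 := hH _ (F.θ_pos x t)
  have h2 := Real.log_le_sub_one_of_pos hv
  have h3 : 0 ≤ F.u x t ^ 2 / 2 + (F.w₁ x t ^ 2 + F.w₂ x t ^ 2) / 2
    + F.v x t * (F.b₁ x t ^ 2 + F.b₂ x t ^ 2) / 2 := by positivity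
  unfold energy
  linarith

/-- The localized weighted energy inequality. -/
lemma exists_energy_inequality {α T K δ p : ℝ} (β : ℝ) (hα : 0 ≤ α) (hT : 0 < T) (hK : 0 < K)
    (hδ : 0 < δ) (hp : 0 < p) {H : ℝ → ℝ} (hH : ∀ z, 0 < z → HasDerivAt H (1 - z ^ (-p)) z)
    (hH₀ : ∀ z, 0 < z → 0 ≤ H z) (hH₁ : ∀ z, 0 < z → H z ≤ (z - 1) ^ 2 / z) :
    ∃ C > 0, ∀ F : MHDFlow α β T K δ, ∃ R₀ ≥ 1, ∀ R ≥ R₀, ∀ t ∈ Icc 0 T,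
      (∫ x in -R..R, cutoff R x ^ 2 * F.energy H x t)
        + 1 / 2 * (∫ s in (0 : ℝ)..t, ∫ x in -R..R, cutoff R x ^ 2 * F.diss p x s)
        ≤ C + ∫ s in (0 : ℝ)..t, ∫ x in -R..R, cutoff R x ^ 2 * F.prod p x s := by
  obtain ⟨C, hC, hdot⟩ := exists_integral_cutoff_energyDot_le β hα hp
  refine ⟨T * C + (1 + K + 1 / δ) * K ^ 2, by positivity, fun F => ?_⟩
  obtain ⟨R₀, hR₀, hR⟩ := hdot F
  refine ⟨R₀, hR₀, fun R hRR t ht => ?_⟩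
  have hR0 : 0 < R := by linarith
  have h1 := F.integral_cutoff_energy_sub hH R ht
  have h2 := F.integral_cutoff_energy_zero_le hK hδ hH hH₁ hR0 (F.energy_nonneg hH₀ · 0)
  have h3 := intervalIntegral.integral_mono_on (μ := volume) ht.1
    (Continuous.intervalIntegrable (by fun_prop) _ _)
    (Continuous.intervalIntegrable (by fun_prop) _ _)
    (fun s hs => hR R hRR s ⟨hs.1, hs.2.trans ht.2⟩)
  rw [intervalIntegral.integral_sub (Continuous.intervalIntegrable (by fun_prop) _ _)
      (Continuous.intervalIntegrable (by fun_prop) _ _),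
    intervalIntegral.integral_add (Continuous.intervalIntegrable (by fun_prop) _ _)
      (Continuous.intervalIntegrable (by fun_prop) _ _),
    intervalIntegral.integral_const, intervalIntegral.integral_const_mul, smul_eq_mul] at h3
  have h4 : (t - 0) * C ≤ T * C := mul_le_mul_of_nonneg_right (by linarith [ht.2]) hC.le
  linarith

end MHDFlow

/-- The relative entropy density `z - log z - 1`. -/
def entropy (z : ℝ) : ℝ := z - Real.log z - 1

lemma hasDerivAt_entropy {z : ℝ} (hz : 0 < z) : HasDerivAt entropy (1 - z ^ (-1 : ℝ)) z := by
  rw [Real.rpow_neg_one]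
  exact ((hasDerivAt_id z).sub (Real.hasDerivAt_log hz.ne')).sub_const 1

lemma entropy_nonneg {z : ℝ} (hz : 0 < z) : 0 ≤ entropy z := by
  have := Real.log_le_sub_one_of_pos hz
  unfold entropy; linarith

lemma entropy_le {z : ℝ} (hz : 0 < z) : entropy z ≤ (z - 1) ^ 2 / z := by
  have := Real.one_sub_inv_le_log_of_pos hz
  have e : (z - 1) ^ 2 / z = z - 2 + z⁻¹ := by field_simp; ring
  unfold entropy; linarith

lemma le_two_mul_entropy_add {z : ℝ} (hz : 0 < z) : z ≤ 2 * entropy z + 2 := by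
  have h := Real.log_le_sub_one_of_pos (show 0 < z / 2 by positivity)
  have h2 := Real.log_le_sub_one_of_pos (show (0 : ℝ) < 2 by norm_num)
  rw [Real.log_div hz.ne' two_ne_zero] at h
  unfold entropy; linarith

namespace MHDFlow

variable {α β T K δ : ℝ} (F : MHDFlow α β T K δ)

@[fun_prop]
lemma continuous_energy_entropy {X : Type*} [TopologicalSpace X] {f g : X → ℝ}
    (hf : Continuous f) (hg : Continuous g) : Continuous fun a => F.energy entropy (f a) (g a) :=
  F.continuous_energy (fun _ hz => hasDerivAt_entropy hz) hf hg

lemma energy_parts (x t : ℝ) : F.u x t ^ 2 / 2 + F.v x t * (F.b₁ x t ^ 2 + F.b₂ x t ^ 2) / 2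
    + entropy (F.θ x t) + entropy (F.v x t) ≤ F.energy entropy x t := by
  have : 0 ≤ (F.w₁ x t ^ 2 + F.w₂ x t ^ 2) / 2 := by positivity
  have e : entropy (F.v x t) = F.v x t - Real.log (F.v x t) - 1 := rfl
  unfold energy; linarith

lemma entropy_v_le (x t : ℝ) : entropy (F.v x t) ≤ F.energy entropy x t := by
  have h := F.energy_parts x t
  have h1 := entropy_nonneg (F.θ_pos x t)
  have hv := F.v_pos x t
  have h2 : 0 ≤ F.u x t ^ 2 / 2 + F.v x t * (F.b₁ x t ^ 2 + F.b₂ x t ^ 2) / 2 := by positivity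
  linarith

lemma entropy_θ_le (x t : ℝ) : entropy (F.θ x t) ≤ F.energy entropy x t := by
  have h := F.energy_parts x t
  have hv := F.v_pos x t
  have h1 := entropy_nonneg hv
  have h2 : 0 ≤ F.u x t ^ 2 / 2 + F.v x t * (F.b₁ x t ^ 2 + F.b₂ x t ^ 2) / 2 := by positivity
  linarith

lemma v_le_energy (x t : ℝ) : F.v x t ≤ 2 * F.energy entropy x t + 2 := by
  linarith [F.entropy_v_le x t, le_two_mul_entropy_add (F.v_pos x t)]

lemma θ_add_le_energy (x t : ℝ) :
    F.θ x t + F.v x t * (F.b₁ x t ^ 2 + F.b₂ x t ^ 2) / 2 ≤ 2 * F.energy entropy x t + 2 := by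
  have h := F.energy_parts x t
  have hv := F.v_pos x t
  have h1 := entropy_nonneg hv
  have h3 := le_two_mul_entropy_add (F.θ_pos x t)
  have h2 : 0 ≤ F.u x t ^ 2 / 2 := by positivity
  have h4 : 0 ≤ F.v x t * (F.b₁ x t ^ 2 + F.b₂ x t ^ 2) / 2 := by positivity
  linarith

lemma abs_u_le_energy (x t : ℝ) : |F.u x t| ≤ 2 * F.energy entropy x t + 2 := by
  have h := F.energy_parts x t
  have hv := F.v_pos x t
  have h1 := entropy_nonneg hv
  have h3 := entropy_nonneg (F.θ_pos x t)
  have h4 : 0 ≤ F.v x t * (F.b₁ x t ^ 2 + F.b₂ x t ^ 2) / 2 := by positivity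
  have h5 : |F.u x t| ≤ F.u x t ^ 2 / 2 + 1 / 2 := by
    rw [← sq_abs]; nlinarith [sq_nonneg (|F.u x t| - 1)]
  have h6 : 0 ≤ F.u x t ^ 2 := sq_nonneg _
  linarith

/-- The basic energy bound on `[0, T]`. -/
structure EnergyBound (E : ℝ) : Prop where
  interval : ∀ a b t, a ≤ b → t ∈ Icc 0 T → ∫ x in a..b, F.energy entropy x t ≤ E
  weighted : ∃ R₀ ≥ 1, ∀ R ≥ R₀, ∀ t ∈ Icc 0 T,
    ∫ x in -R..R, cutoff R x ^ 2 * F.energy entropy x t ≤ E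

lemma exists_energyBound {α T K δ : ℝ} (β : ℝ) (hα : 0 ≤ α) (hT : 0 < T) (hK : 0 < K)
    (hδ : 0 < δ) : ∃ E > 0, ∀ F : MHDFlow α β T K δ, F.EnergyBound E := by
  obtain ⟨C, hC, h⟩ := exists_energy_inequality β hα hT hK hδ one_pos
    (fun _ hz => hasDerivAt_entropy hz) (fun _ hz => entropy_nonneg hz) (fun _ hz => entropy_le hz)
  have key : ∀ F : MHDFlow α β T K δ, ∃ R₀ ≥ 1, ∀ R ≥ R₀, ∀ t ∈ Icc 0 T,
      ∫ x in -R..R, cutoff R x ^ 2 * F.energy entropy x t ≤ C := by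
    intro F
    obtain ⟨R₀, hR₀, hR⟩ := h F
    refine ⟨R₀, hR₀, fun R hRR t ht => ?_⟩
    have h1 := hR R hRR t ht
    have h2 : 0 ≤ ∫ s in (0 : ℝ)..t, ∫ x in -R..R, cutoff R x ^ 2 * F.diss 1 x s :=
      intervalIntegral.integral_nonneg ht.1 fun s _ =>
        intervalIntegral.integral_nonneg (by linarith) fun x _ =>
          mul_nonneg (sq_nonneg _) (F.diss_nonneg hα zero_le_one x s)
    have h3 (x s : ℝ) : F.prod 1 x s = 0 := by simp [prod]
    simp only [h3, mul_zero, intervalIntegral.integral_zero, add_zero] at h1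
    linarith
  refine ⟨2 * C, by positivity, fun F => ⟨fun a b t hab ht => ?_, ?_⟩⟩
  · obtain ⟨R₀, hR₀, hR⟩ := key F
    set R := max R₀ (2 * max |a| |b|)
    have hRa : 2 * |a| ≤ R := (by gcongr; exact le_max_left _ _ : 2 * |a| ≤ 2 * max |a| |b|).trans
      (le_max_right _ _)
    have hRb : 2 * |b| ≤ R := (by gcongr; exact le_max_right _ _ : 2 * |b| ≤ 2 * max |a| |b|).trans
      (le_max_right _ _)
    have hR1 : 1 ≤ R := hR₀.trans (le_max_left _ _)
    have h1 := hR R (le_max_left _ _) t ht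
    have h2 : ∫ x in a..b, cutoff R x ^ 2 * F.energy entropy x t ≤
        ∫ x in -R..R, cutoff R x ^ 2 * F.energy entropy x t := by
      refine intervalIntegral.integral_mono_interval ?_ hab ?_ ?_
        (Continuous.intervalIntegrable (by fun_prop) _ _)
      · linarith [neg_abs_le a, abs_nonneg a]
      · linarith [le_abs_self b, abs_nonneg b]
      · exact Filter.Eventually.of_forall fun x =>
          mul_nonneg (sq_nonneg _) (F.energy_nonneg (fun _ hz => entropy_nonneg hz) x t)
    have h3 := intervalIntegral.integral_mono_on (μ := volume) hab
      (f := fun x => 1 / 2 * F.energy entropy x t)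
      (g := fun x => cutoff R x ^ 2 * F.energy entropy x t)
      (Continuous.intervalIntegrable (by fun_prop) _ _)
      (Continuous.intervalIntegrable (by fun_prop) _ _) (fun x hx => by
        refine mul_le_mul_of_nonneg_right (one_half_le_cutoff_sq (by linarith) ?_)
          (F.energy_nonneg (fun _ hz => entropy_nonneg hz) x t)
        have : |x| ≤ max |a| |b| := abs_le_max_abs_abs hx.1 hx.2
        exact (by gcongr : 2 * |x| ≤ 2 * max |a| |b|).trans (le_max_right _ _))
    rw [intervalIntegral.integral_const_mul] at h3
    linarith
  · obtain ⟨R₀, hR₀, hR⟩ := key F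
    exact ⟨R₀, hR₀, fun R hRR t ht => (hR R hRR t ht).trans (by linarith)⟩

variable {F} {E : ℝ}

lemma EnergyBound.integral_le (hE : F.EnergyBound E) {f : ℝ → ℝ} (hf : Continuous f) {x t : ℝ}
    (ht : t ∈ Icc 0 T)
    (h : ∀ y, f y ≤ 2 * F.energy entropy y t + 2) : ∫ y in x..x + 1, f y ≤ 2 * E + 2 := by
  have h1 := intervalIntegral.integral_mono_on (μ := volume) (by linarith : x ≤ x + 1)
    (hf.intervalIntegrable _ _) (Continuous.intervalIntegrable (by fun_prop) _ _) (fun y _ => h y)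
  rw [intervalIntegral.integral_add (Continuous.intervalIntegrable (by fun_prop) _ _)
    (Continuous.intervalIntegrable (by fun_prop) _ _), intervalIntegral.integral_const_mul,
    intervalIntegral.integral_const, smul_eq_mul] at h1
  linarith [hE.interval x (x + 1) t (by linarith) ht]

lemma EnergyBound.exists_θ_le (hE : F.EnergyBound E) (x : ℝ) {t : ℝ} (ht : t ∈ Icc 0 T) :
    ∃ y ∈ Icc x (x + 1), F.θ y t ≤ 2 * E + 3 := by
  by_contra! hcon
  have h1 := intervalIntegral.integral_mono_on (μ := volume) (by linarith : x ≤ x + 1)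
    (f := fun _ => 2 * E + 3) (g := fun y => F.θ y t)
    (Continuous.intervalIntegrable (by fun_prop) _ _)
    (Continuous.intervalIntegrable (by fun_prop) _ _) (fun y hy => (hcon y hy).le)
  rw [intervalIntegral.integral_const, smul_eq_mul] at h1
  have h2 := hE.integral_le (f := fun y => F.θ y t) (by fun_prop) (x := x) ht fun y => by
    have hv := F.v_pos y t
    have : 0 ≤ F.v y t * (F.b₁ y t ^ 2 + F.b₂ y t ^ 2) / 2 := by positivity
    linarith [F.θ_add_le_energy y t]
  linarith

end MHDFlow

lemma le_of_le_mul_one_add_integral {T C B : ℝ} (hC : 0 ≤ C) (hB : 0 ≤ B) {f : ℝ → ℝ}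
    (hf : Continuous f) (h : ∀ t ∈ Icc 0 T, f t ≤ C * (1 + B * ∫ s in (0 : ℝ)..t, f s)) {t : ℝ}
    (ht : t ∈ Icc 0 T) : f t ≤ C * Real.exp (C * B * T) := by
  have hd (s : ℝ) : HasDerivAt (fun r => (1 + B * ∫ z in (0 : ℝ)..r, f z) * Real.exp (-(C * B * r)))
      (B * f s * Real.exp (-(C * B * s))
        + (1 + B * ∫ z in (0 : ℝ)..s, f z) * (Real.exp (-(C * B * s)) * -(C * B))) s := by
    have h1 := ((hf.integral_hasStrictDerivAt 0 s).hasDerivAt.const_mul B).const_add 1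
    have h2 := (((hasDerivAt_id s).const_mul (C * B)).neg).exp
    refine (h1.mul h2).congr_deriv ?_
    simp
  have hanti : AntitoneOn (fun r => (1 + B * ∫ z in (0 : ℝ)..r, f z) * Real.exp (-(C * B * r)))
      (Icc 0 T) := by
    refine antitoneOn_of_deriv_nonpos (convex_Icc 0 T)
      (fun s _ => (hd s).continuousAt.continuousWithinAt)
      (fun s _ => (hd s).differentiableAt.differentiableWithinAt) fun s hs => ?_
    rw [interior_Icc] at hs
    rw [(hd s).deriv]
    have h1 := mul_le_mul_of_nonneg_left (h s ⟨hs.1.le, hs.2.le⟩)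
      (mul_nonneg hB (Real.exp_nonneg (-(C * B * s))))
    linarith
  have h0 := hanti ⟨le_rfl, ht.1.trans ht.2⟩ ht ht.1
  simp only [intervalIntegral.integral_same, mul_zero, neg_zero, Real.exp_zero, add_zero,
    mul_one] at h0
  rw [Real.exp_neg, ← div_eq_mul_inv, div_le_one (Real.exp_pos _)] at h0
  refine (h t ht).trans (mul_le_mul_of_nonneg_left (h0.trans ?_) hC)
  rw [Real.exp_le_exp]
  exact mul_le_mul_of_nonneg_left ht.2 (mul_nonneg hC hB)

/-- The primitive `log z - z ^ (-α)` of `μ(z) / z`. -/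
def viscLog (α z : ℝ) : ℝ := Real.log z - z ^ (-α)

lemma hasDerivAt_viscLog (α : ℝ) {z : ℝ} (hz : 0 < z) :
    HasDerivAt (viscLog α) (visc α z / z) z := by
  have h := (Real.hasDerivAt_log hz.ne').sub (Real.hasDerivAt_rpow_const (p := -α) (Or.inl hz.ne'))
  refine h.congr_deriv ?_
  rw [Real.rpow_sub_one hz.ne', visc]
  field_simp
  ring

lemma viscLog_mono {α : ℝ} (hα : 0 ≤ α) {y z : ℝ} (hy : 0 < y) (h : y ≤ z) :
    viscLog α y ≤ viscLog α z := by
  have h1 := Real.log_le_log hy h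
  have h2 := Real.rpow_le_rpow_of_nonpos hy h (neg_nonpos.2 hα)
  unfold viscLog; linarith

lemma exp_viscLog_le {z : ℝ} (α : ℝ) (hz : 0 < z) : Real.exp (viscLog α z) ≤ z := by
  rw [← Real.le_log_iff_exp_le hz]
  have : 0 ≤ z ^ (-α) := by positivity
  unfold viscLog; linarith

lemma exists_le_exp_viscLog {α : ℝ} (hα : 0 ≤ α) {E : ℝ} (hE : 0 < E) :
    ∃ c > 0, ∀ z, 0 < z → c * (1 - entropy z / (2 * E)) ≤ Real.exp (viscLog α z) := by
  refine ⟨Real.exp (viscLog α (Real.exp (-1 - 2 * E))), Real.exp_pos _, fun z hz => ?_⟩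
  rcases le_total (2 * E) (entropy z) with h | h
  · have h1 : 1 - entropy z / (2 * E) ≤ 0 := by
      rw [sub_nonpos, le_div_iff₀ (by positivity)]; linarith
    exact (mul_nonpos_of_nonneg_of_nonpos (Real.exp_nonneg _) h1).trans (Real.exp_nonneg _)
  · have h1 : 0 ≤ entropy z / (2 * E) := div_nonneg (entropy_nonneg hz) (by positivity)
    have h2 : Real.exp (-1 - 2 * E) ≤ z := by
      rw [← Real.le_log_iff_exp_le hz]
      unfold entropy at h; linarith
    have h3 := Real.exp_le_exp.2 (viscLog_mono hα (Real.exp_pos _) h2)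
    nlinarith [Real.exp_pos (viscLog α (Real.exp (-1 - 2 * E)))]

namespace MHDFlow

variable {α β T K δ : ℝ} (F : MHDFlow α β T K δ)

/-- The total pressure `θ / v + |b|² / 2`. -/
def pressure (x t : ℝ) : ℝ := F.θ x t / F.v x t + (F.b₁ x t ^ 2 + F.b₂ x t ^ 2) / 2

@[fun_prop]
lemma continuous_pressure {X : Type*} [TopologicalSpace X] {f g : X → ℝ}
    (hf : Continuous f) (hg : Continuous g) : Continuous fun a => F.pressure (f a) (g a) := by
  simp only [pressure, div_eq_mul_inv]; fun_prop

@[fun_prop]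
lemma continuous_viscLog {X : Type*} [TopologicalSpace X] {f g : X → ℝ}
    (hf : Continuous f) (hg : Continuous g) : Continuous fun a => viscLog α (F.v (f a) (g a)) := by
  simp only [viscLog]; fun_prop

lemma pressure_nonneg (x t : ℝ) : 0 ≤ F.pressure x t := by
  have := F.v_pos x t
  have := F.θ_pos x t
  unfold pressure; positivity

lemma pressure_mul_v (x t : ℝ) : F.pressure x t * F.v x t =
    F.θ x t + F.v x t * (F.b₁ x t ^ 2 + F.b₂ x t ^ 2) / 2 := by
  have := (F.v_pos x t).ne'
  unfold pressure; field_simp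

lemma viscLog_eq (x₀ x : ℝ) {t : ℝ} (ht : t ∈ Icc 0 T) :
    viscLog α (F.v x t) = (viscLog α (F.v x 0) + ((∫ y in x₀..x, F.u y t) - ∫ y in x₀..x, F.u y 0))
      + (∫ s in (0 : ℝ)..t, F.stress x₀ s) + ∫ s in (0 : ℝ)..t, F.pressure x s := by
  have h1 := sub_eq_integral_of_time_deriv ht
    (f := fun s => viscLog α (F.v x s)) (f' := fun s => F.stress x s + F.pressure x s)
    (by fun_prop) (by fun_prop) fun s hs => by
      refine ((hasDerivAt_viscLog α (F.v_pos x s)).comp s (F.time_v x s hs)).congr_deriv ?_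
      unfold stress pressure; ring
  have h2 (s : ℝ) : F.stress x s = F.stress x₀ s + ∫ y in x₀..x, F.ut y s := by
    have := intervalIntegral.integral_eq_sub_of_hasDerivAt (a := x₀) (b := x)
      (fun y _ => F.momentum y s) (Continuous.intervalIntegrable (by fun_prop) _ _)
    rw [this]; unfold stress; ring
  have h3 : ∫ s in (0 : ℝ)..t, ∫ y in x₀..x, F.ut y s =
      (∫ y in x₀..x, F.u y t) - ∫ y in x₀..x, F.u y 0 := by
    rw [← intervalIntegral_swap_of_continuous (by fun_prop),
      ← intervalIntegral.integral_sub (Continuous.intervalIntegrable (by fun_prop) _ _)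
        (Continuous.intervalIntegrable (by fun_prop) _ _)]
    refine intervalIntegral.integral_congr fun y _ => ?_
    exact sub_eq_integral_of_time_deriv ht (f := fun s => F.u y s) (by fun_prop) (by fun_prop)
      fun s hs => F.time_u y s hs
  rw [intervalIntegral.integral_add (Continuous.intervalIntegrable (by fun_prop) _ _)
    (Continuous.intervalIntegrable (by fun_prop) _ _),
    intervalIntegral.integral_congr (fun s _ => h2 s),
    intervalIntegral.integral_add (Continuous.intervalIntegrable (by fun_prop) _ _)
    (Continuous.intervalIntegrable (by fun_prop) _ _), h3] at h1
  linarith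

variable {F} {E : ℝ}

lemma EnergyBound.abs_integral_u_le (hE : F.EnergyBound E) {x₀ x t : ℝ}
    (hx : x ∈ Icc x₀ (x₀ + 1)) (ht : t ∈ Icc 0 T) : |∫ y in x₀..x, F.u y t| ≤ 2 * E + 2 := by
  refine (intervalIntegral.abs_integral_le_integral_abs hx.1).trans ?_
  refine (intervalIntegral.integral_mono_interval le_rfl hx.1 hx.2
    (Filter.Eventually.of_forall fun y => abs_nonneg _)
    (Continuous.intervalIntegrable (by fun_prop) _ _)).trans ?_
  exact hE.integral_le (by fun_prop) ht fun y => F.abs_u_le_energy y t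

lemma exists_viscLog_decomposition (α β T : ℝ) {K δ E : ℝ} (hδ : 0 < δ) :
    ∃ A, ∀ F : MHDFlow α β T K δ, F.EnergyBound E → ∀ x₀, ∀ x ∈ Icc x₀ (x₀ + 1), ∀ t ∈ Icc 0 T,
      |viscLog α (F.v x t) - (∫ s in (0 : ℝ)..t, F.stress x₀ s)
        - ∫ s in (0 : ℝ)..t, F.pressure x s| ≤ A := by
  obtain ⟨B, hB⟩ := (isCompact_Icc (a := δ) (b := 1 + 2 * K)).exists_bound_of_continuousOn
    (f := viscLog α) fun z hz =>
      (hasDerivAt_viscLog α (hδ.trans_le hz.1)).continuousAt.continuousWithinAt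
  refine ⟨B + (2 * (2 * E + 2)), fun F hE x₀ x hx t ht => ?_⟩
  rw [F.viscLog_eq x₀ x ht]
  have h1 := abs_le.1 (hB _ (F.init_v x))
  have h2 := abs_le.1 (hE.abs_integral_u_le hx ht)
  have h3 := abs_le.1 (hE.abs_integral_u_le hx ⟨le_rfl, ht.1.trans ht.2⟩)
  rw [abs_le]
  constructor <;> linarith [h1.1, h1.2, h2.1, h2.2, h3.1, h3.2]

lemma exists_lower_bound_v {α T K δ E : ℝ} (β : ℝ) (hα : 0 ≤ α) (hδ : 0 < δ) (hE : 0 < E) :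
    ∃ c > 0, ∀ F : MHDFlow α β T K δ, F.EnergyBound E → ∀ x, ∀ t ∈ Icc 0 T, c ≤ F.v x t := by
  obtain ⟨A, hA⟩ := exists_viscLog_decomposition α β T (K := K) (E := E) hδ
  obtain ⟨c, hc, hcz⟩ := exists_le_exp_viscLog hα hE
  set C := 2 * Real.exp A / c with hC
  set B := Real.exp A * (2 * E + 2) with hB
  have hC0 : 0 < C := by positivity
  have hB0 : 0 < B := by positivity
  refine ⟨Real.exp (-A) / (C * Real.exp (C * B * T)), by positivity, fun F hF x₀ t ht => ?_⟩
  set S : ℝ → ℝ := fun r => ∫ s in (0 : ℝ)..r, F.stress x₀ s with hS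
  have hSc : Continuous S :=
    intervalIntegral.continuous_primitive
      (fun a b => Continuous.intervalIntegrable (by fun_prop) _ _) 0
  have hexp (x : ℝ) (hx : x ∈ Icc x₀ (x₀ + 1)) (r : ℝ) (hr : r ∈ Icc 0 T) :
      Real.exp (∫ s in (0 : ℝ)..r, F.pressure x s) ≤ 1 + Real.exp A * ∫ s in (0 : ℝ)..r,
        (F.θ x s + F.v x s * (F.b₁ x s ^ 2 + F.b₂ x s ^ 2) / 2) * Real.exp (-S s) := by
    have hd (s : ℝ) : HasDerivAt (fun r => Real.exp (∫ z in (0 : ℝ)..r, F.pressure x z))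
        (Real.exp (∫ z in (0 : ℝ)..s, F.pressure x z) * F.pressure x s) s :=
      ((by fun_prop : Continuous fun z => F.pressure x z).integral_hasStrictDerivAt
        0 s).hasDerivAt.exp
    have hQc : Continuous fun r => ∫ z in (0 : ℝ)..r, F.pressure x z :=
      intervalIntegral.continuous_primitive
        (fun a b => Continuous.intervalIntegrable (by fun_prop) _ _) 0
    have h1 := intervalIntegral.integral_eq_sub_of_hasDerivAt (a := 0) (b := r)
      (fun s _ => hd s) (Continuous.intervalIntegrable (by fun_prop) _ _)
    have h2 := intervalIntegral.integral_mono_on (μ := volume) hr.1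
      (f := fun s => Real.exp (∫ z in (0 : ℝ)..s, F.pressure x z) * F.pressure x s)
      (g := fun s => Real.exp A *
        ((F.θ x s + F.v x s * (F.b₁ x s ^ 2 + F.b₂ x s ^ 2) / 2) * Real.exp (-S s)))
      (Continuous.intervalIntegrable (by fun_prop) _ _)
      (Continuous.intervalIntegrable (by simp only [div_eq_mul_inv]; fun_prop) _ _) fun s hs => by
        have h3 := abs_le.1 (hA F hF x₀ x hx s ⟨hs.1, hs.2.trans hr.2⟩)
        have h4 : Real.exp (∫ z in (0 : ℝ)..s, F.pressure x z) ≤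
            Real.exp A * Real.exp (-S s) * F.v x s := by
          refine le_trans ?_ (mul_le_mul_of_nonneg_left (exp_viscLog_le α (F.v_pos x s))
            (by positivity))
          rw [← Real.exp_add, ← Real.exp_add, Real.exp_le_exp]
          simp only [hS]
          linarith [h3.1]
        have h5 := mul_le_mul_of_nonneg_right h4 (F.pressure_nonneg x s)
        rw [← F.pressure_mul_v]
        linarith
    rw [intervalIntegral.integral_const_mul, h1] at h2
    simp only [intervalIntegral.integral_same, Real.exp_zero] at h2
    linarith
  have hgron : ∀ r ∈ Icc 0 T, Real.exp (-S r) ≤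
        C * (1 + B * ∫ s in (0 : ℝ)..r, Real.exp (-S s)) := by
    intro r hr
    have hlow : c / 2 ≤ ∫ x in x₀..x₀ + 1, Real.exp (viscLog α (F.v x r)) := by
      have h1 := intervalIntegral.integral_mono_on (μ := volume) (by linarith : x₀ ≤ x₀ + 1)
        (f := fun x => c - c / (2 * E) * F.energy entropy x r)
        (g := fun x => Real.exp (viscLog α (F.v x r)))
        (Continuous.intervalIntegrable (by fun_prop) _ _)
        (Continuous.intervalIntegrable (by fun_prop) _ _) fun x _ => by
          refine le_trans ?_ (hcz _ (F.v_pos x r))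
          have h2 := mul_le_mul_of_nonneg_left (F.entropy_v_le x r)
            (by positivity : 0 ≤ c / (2 * E))
          have e : c * (1 - entropy (F.v x r) / (2 * E)) = c - c / (2 * E) * entropy (F.v x r) := by
            ring
          linarith
      rw [intervalIntegral.integral_sub (Continuous.intervalIntegrable (by fun_prop) _ _)
        (Continuous.intervalIntegrable (by fun_prop) _ _), intervalIntegral.integral_const_mul,
        intervalIntegral.integral_const, smul_eq_mul] at h1
      have h2 := mul_le_mul_of_nonneg_left (hF.interval x₀ (x₀ + 1) r (by linarith) hr)
        (by positivity : 0 ≤ c / (2 * E))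
      have e : c / (2 * E) * E = c / 2 := by field_simp
      linarith
    have hup := intervalIntegral.integral_mono_on (μ := volume) (by linarith : x₀ ≤ x₀ + 1)
      (f := fun x => Real.exp (viscLog α (F.v x r)))
      (g := fun x => Real.exp A * Real.exp (S r) * (1 + Real.exp A * ∫ s in (0 : ℝ)..r,
        (F.θ x s + F.v x s * (F.b₁ x s ^ 2 + F.b₂ x s ^ 2) / 2) * Real.exp (-S s)))
      (Continuous.intervalIntegrable (by fun_prop) _ _)
      (Continuous.intervalIntegrable (by simp only [div_eq_mul_inv]; fun_prop) _ _) fun x hx => by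
        refine le_trans ?_ (mul_le_mul_of_nonneg_left (hexp x hx r hr) (by positivity))
        rw [← Real.exp_add, ← Real.exp_add, Real.exp_le_exp]
        have h3 := abs_le.1 (hA F hF x₀ x hx r hr)
        simp only [hS]
        linarith [h3.2]
    rw [intervalIntegral.integral_const_mul,
      intervalIntegral.integral_add (Continuous.intervalIntegrable (by fun_prop) _ _)
        (Continuous.intervalIntegrable (by simp only [div_eq_mul_inv]; fun_prop) _ _),
      intervalIntegral.integral_const, intervalIntegral.integral_const_mul, smul_eq_mul,
      intervalIntegral_swap_of_continuous (by simp only [div_eq_mul_inv]; fun_prop)] at hup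
    have hg := intervalIntegral.integral_mono_on (μ := volume) hr.1
      (f := fun s => ∫ x in x₀..x₀ + 1,
        (F.θ x s + F.v x s * (F.b₁ x s ^ 2 + F.b₂ x s ^ 2) / 2) * Real.exp (-S s))
      (g := fun s => (2 * E + 2) * Real.exp (-S s))
      (Continuous.intervalIntegrable (by simp only [div_eq_mul_inv]; fun_prop) _ _)
      (Continuous.intervalIntegrable (by fun_prop) _ _) fun s hs => by
        simp only [intervalIntegral.integral_mul_const]
        refine mul_le_mul_of_nonneg_right ?_ (Real.exp_nonneg _)
        exact hF.integral_le (by simp only [div_eq_mul_inv]; fun_prop) ⟨hs.1, hs.2.trans hr.2⟩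
          fun y => F.θ_add_le_energy y s
    rw [intervalIntegral.integral_const_mul] at hg
    have h6 := mul_le_mul_of_nonneg_left hg (Real.exp_nonneg A)
    have h7 : c / 2 ≤ Real.exp A * Real.exp (S r) *
        (1 + B * ∫ s in (0 : ℝ)..r, Real.exp (-S s)) := by
      refine hlow.trans (hup.trans (mul_le_mul_of_nonneg_left ?_ (by positivity)))
      rw [hB]
      linarith
    have h8 := mul_le_mul_of_nonneg_left h7 (by positivity : 0 ≤ 2 / c * Real.exp (-S r))
    have e1 : 2 / c * Real.exp (-S r) * (c / 2) = Real.exp (-S r) := by field_simp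
    have e2 : Real.exp (-S r) * Real.exp (S r) = 1 := by rw [← Real.exp_add]; simp
    rw [e1] at h8
    refine h8.trans (le_of_eq ?_)
    rw [hC]
    linear_combination (2 / c * Real.exp A * (1 + B * ∫ s in (0 : ℝ)..r, Real.exp (-S s))) * e2
  have hSt := le_of_le_mul_one_add_integral hC0.le hB0.le (f := fun r => Real.exp (-S r))
    (by fun_prop) hgron ht
  have h1 := abs_le.1 (hA F hF x₀ x₀ ⟨le_rfl, by linarith⟩ t ht)
  have h2 : 0 ≤ ∫ s in (0 : ℝ)..t, F.pressure x₀ s :=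
    intervalIntegral.integral_nonneg ht.1 fun s _ => F.pressure_nonneg x₀ s
  have h3 : Real.exp (-A) * Real.exp (S t) ≤ F.v x₀ t := by
    refine le_trans ?_ (exp_viscLog_le α (F.v_pos x₀ t))
    rw [← Real.exp_add, Real.exp_le_exp]
    simp only [hS]
    linarith [h1.1]
  refine le_trans ?_ h3
  rw [div_eq_mul_inv]
  refine mul_le_mul_of_nonneg_left ?_ (Real.exp_nonneg _)
  rw [← inv_inv (Real.exp (S t)), ← Real.exp_neg]
  exact inv_anti₀ (Real.exp_pos _) hSt

end MHDFlow

lemma exists_rpow_le_add {a β ε : ℝ} (ha : 0 < a) (hβ : 0 < β) (hε : 0 < ε) :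
    ∃ N > 0, ∀ z : ℝ, 0 < z → z ^ a ≤ N + ε * z ^ (a + β) := by
  have hZ : 0 < ε ^ (-β⁻¹) := by positivity
  refine ⟨(ε ^ (-β⁻¹)) ^ a, by positivity, fun z hz => ?_⟩
  rcases le_total z (ε ^ (-β⁻¹)) with h | h
  · have h1 := Real.rpow_le_rpow hz.le h ha.le
    have : 0 ≤ ε * z ^ (a + β) := by positivity
    linarith
  · have h1 := Real.rpow_le_rpow hZ.le h hβ.le
    rw [← Real.rpow_mul hε.le, neg_mul, inv_mul_cancel₀ hβ.ne', Real.rpow_neg_one] at h1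
    have h2 : 1 ≤ ε * z ^ β := by
      have := mul_le_mul_of_nonneg_left h1 hε.le
      rwa [mul_inv_cancel₀ hε.ne'] at this
    have h3 := mul_le_mul_of_nonneg_left h2 (by positivity : 0 ≤ z ^ a)
    rw [Real.rpow_add hz]
    have : 0 ≤ (ε ^ (-β⁻¹)) ^ a := by positivity
    linarith

lemma sqrt_sub_one_sq_le_entropy {s : ℝ} (hs : 0 < s) : (s - 1) ^ 2 ≤ entropy (s ^ 2) := by
  have := Real.log_le_sub_one_of_pos hs
  unfold entropy
  rw [Real.log_pow]
  push_cast
  nlinarith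

lemma rpow_mul_sq_le_entropy {p z : ℝ} (hp0 : 0 < p) (hp1 : p < 1) (hz : 0 < z) :
    z ^ p * (z ^ (1 - p) - 1) ^ 2 ≤ 4 * (1 + z ^ (1 - p)) * entropy z := by
  obtain ⟨s, hs, rfl⟩ : ∃ s, 0 < s ∧ z = s ^ 2 :=
    ⟨√z, Real.sqrt_pos.2 hz, (Real.sq_sqrt hz.le).symm⟩
  have e (q : ℝ) : (s ^ 2) ^ q = (s ^ q) ^ 2 := by
    rw [← Real.rpow_natCast, ← Real.rpow_natCast, ← Real.rpow_mul hs.le, ← Real.rpow_mul hs.le,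
      mul_comm]
  rw [e, e]
  have hX : 0 < s ^ p := by positivity
  have hY : 0 < s ^ (1 - p) := by positivity
  have hXY : s ^ p * s ^ (1 - p) = s := by rw [← Real.rpow_add hs]; simp
  refine le_trans ?_ (mul_le_mul_of_nonneg_left (sqrt_sub_one_sq_le_entropy hs) (by positivity))
  rcases le_total 1 s with h | h
  · have hX1 : 1 ≤ s ^ p := Real.one_le_rpow h hp0.le
    have hY1 : 1 ≤ s ^ (1 - p) := Real.one_le_rpow h (by linarith)
    generalize s ^ p = X at *
    generalize s ^ (1 - p) = Y at *
    subst hXY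
    have h1 : 0 ≤ X * (Y ^ 2 - 1) := mul_nonneg hX.le (by nlinarith)
    have h2 : X * (Y ^ 2 - 1) ≤ 2 * Y * (X * Y - 1) := by
      have h3 : 0 ≤ X * (2 * Y * (X * Y - 1) - X * (Y ^ 2 - 1)) := by
        nlinarith [sq_nonneg (X * Y - 1)]
      linarith [nonneg_of_mul_nonneg_right h3 hX]
    have h4 := pow_le_pow_left₀ h1 h2 2
    nlinarith [sq_nonneg (X * Y - 1)]
  · have hX1 : s ^ p ≤ 1 := Real.rpow_le_one hs.le h hp0.le
    have hY1 : s ^ (1 - p) ≤ 1 := Real.rpow_le_one hs.le h (by linarith)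
    generalize s ^ p = X at *
    generalize s ^ (1 - p) = Y at *
    subst hXY
    have h1 : 0 ≤ X * (1 - Y ^ 2) := mul_nonneg hX.le (by nlinarith)
    have h2 : X * (1 - Y ^ 2) ≤ 2 * (1 - X * Y) := by
      nlinarith [mul_nonneg hX.le (sq_nonneg (1 - Y))]
    have h4 := pow_le_pow_left₀ h1 h2 2
    nlinarith [mul_nonneg (sq_nonneg Y) (sq_nonneg (X * Y - 1))]

/-- The thermal energy with derivative `1 - z ^ (-p)`. -/
def thermal (p z : ℝ) : ℝ := z - 1 - (z ^ (1 - p) - 1) / (1 - p)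

lemma hasDerivAt_thermal {p z : ℝ} (hp : p < 1) (hz : 0 < z) :
    HasDerivAt (thermal p) (1 - z ^ (-p)) z := by
  have h := ((hasDerivAt_id z).sub_const 1).sub
    (((Real.hasDerivAt_rpow_const (p := 1 - p) (Or.inl hz.ne')).sub_const 1).div_const (1 - p))
  refine h.congr_deriv ?_
  have : 1 - p ≠ 0 := by linarith
  rw [show 1 - p - 1 = -p by ring]
  field_simp

lemma thermal_nonneg {p z : ℝ} (hp0 : 0 < p) (hp1 : p < 1) (hz : 0 < z) : 0 ≤ thermal p z := by
  have h := rpow_one_add_le_one_add_mul_self (s := z - 1) (by linarith) (p := 1 - p)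
    (by linarith) (by linarith)
  rw [show 1 + (z - 1) = z by ring] at h
  have : (z ^ (1 - p) - 1) / (1 - p) ≤ z - 1 := by
    rw [div_le_iff₀ (by linarith)]; linarith
  unfold thermal; linarith

lemma thermal_le {p z : ℝ} (hp1 : p < 1) (hz : 0 < z) : thermal p z ≤ (z - 1) ^ 2 / z := by
  refine le_trans ?_ (entropy_le hz)
  have h := Real.log_le_sub_one_of_pos (show 0 < z ^ (1 - p) by positivity)
  rw [Real.log_rpow hz] at h
  have : Real.log z ≤ (z ^ (1 - p) - 1) / (1 - p) := by
    rw [le_div_iff₀ (by linarith)]; linarith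
  unfold thermal entropy; linarith

namespace MHDFlow

variable {α β T K δ : ℝ} (F : MHDFlow α β T K δ)

/-- The weighted thermal dissipation density. -/
def thermalDiss (p x t : ℝ) : ℝ := F.θ x t ^ (β - p - 1) * F.θx x t ^ 2 / F.v x t

@[fun_prop]
lemma continuous_thermalDiss (p : ℝ) {X : Type*} [TopologicalSpace X] {f g : X → ℝ}
    (hf : Continuous f) (hg : Continuous g) :
    Continuous fun a => F.thermalDiss p (f a) (g a) := by
  simp only [thermalDiss, div_eq_mul_inv]; fun_prop

lemma thermalDiss_nonneg (p x t : ℝ) : 0 ≤ F.thermalDiss p x t := by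
  have := F.v_pos x t
  have := F.θ_pos x t
  unfold thermalDiss; positivity

variable {F} {E : ℝ}

lemma EnergyBound.θ_rpow_le (hE : F.EnergyBound E) (hE₀ : 0 < E) {p r : ℝ} (hr : 0 < r)
    (hrp : 2 * r = β - p + 1) {R x t : ℝ} (hR : 2 * (|x| + 1) ≤ R) (ht : t ∈ Icc 0 T) :
    F.θ x t ^ (2 * r) ≤ 4 * ((2 * E + 3) ^ r) ^ 2
      + 4 * r ^ 2 * (2 * E + 2) * ∫ z in -R..R, cutoff R z ^ 2 * F.thermalDiss p z t := by
  obtain ⟨y, hy, hyθ⟩ := hE.exists_θ_le x ht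
  set W := ∫ z in -R..R, cutoff R z ^ 2 * F.thermalDiss p z t with hW
  have hx0 := abs_nonneg x
  have hR0 : 0 < R := by linarith
  have hθ := F.θ_pos x t
  set X := F.θ x t ^ r with hX
  have hX0 : 0 < X := by positivity
  have hXX : F.θ x t ^ (2 * r) = X ^ 2 := by
    rw [hX, ← Real.rpow_natCast, ← Real.rpow_mul hθ.le, mul_comm]; norm_cast
  have hYr : F.θ y t ^ r ≤ (2 * E + 3) ^ r := Real.rpow_le_rpow (F.θ_pos y t).le hyθ hr.le
  have hW1 : ∫ z in x..x + 1, F.thermalDiss p z t ≤ 2 * W := by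
    have h1 := intervalIntegral.integral_mono_on (μ := volume) (by linarith : x ≤ x + 1)
      (f := fun z => 1 / 2 * F.thermalDiss p z t)
      (g := fun z => cutoff R z ^ 2 * F.thermalDiss p z t)
      (Continuous.intervalIntegrable (by fun_prop) _ _)
      (Continuous.intervalIntegrable (by fun_prop) _ _) fun z hz => by
        refine mul_le_mul_of_nonneg_right (one_half_le_cutoff_sq hR0 ?_)
          (F.thermalDiss_nonneg p z t)
        have : |z| ≤ |x| + 1 := by
          rw [abs_le]
          constructor <;> linarith [hz.1, hz.2, neg_abs_le x, le_abs_self x]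
        linarith
    have h2 : ∫ z in x..x + 1, cutoff R z ^ 2 * F.thermalDiss p z t ≤ W := by
      refine intervalIntegral.integral_mono_interval ?_ (by linarith) ?_ ?_
        (Continuous.intervalIntegrable (by fun_prop) _ _)
      · linarith [neg_abs_le x]
      · linarith [le_abs_self x]
      · exact Filter.Eventually.of_forall fun z =>
          mul_nonneg (sq_nonneg _) (F.thermalDiss_nonneg p z t)
    rw [intervalIntegral.integral_const_mul] at h1
    linarith
  have hV : ∫ z in x..x + 1, F.v z t ≤ 2 * E + 2 :=
    hE.integral_le (by fun_prop) ht fun z => F.v_le_energy z t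
  set l := r * (2 * E + 2) / X with hl
  have hl0 : 0 < l := by positivity
  have hdiff : X - F.θ y t ^ r ≤ r / 2 * (l * (2 * W) + (2 * E + 2) / l) := by
    have h1 := intervalIntegral.integral_eq_sub_of_hasDerivAt (a := x) (b := y)
      (fun z _ => (F.deriv_θ z t).rpow_const (p := r) (Or.inl (F.θ_pos z t).ne'))
      (Continuous.intervalIntegrable (by fun_prop) _ _)
    have h2 : X - F.θ y t ^ r ≤ ∫ z in x..x + 1, |F.θx z t * r * F.θ z t ^ (r - 1)| := by
      have h3 := (intervalIntegral.abs_integral_le_integral_abs (μ := volume) hy.1).trans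
        (intervalIntegral.integral_mono_interval (f := fun z => |F.θx z t * r * F.θ z t ^ (r - 1)|)
          le_rfl hy.1 hy.2
          (Filter.Eventually.of_forall fun y => abs_nonneg _)
          (Continuous.intervalIntegrable (by fun_prop) _ _))
      rw [h1] at h3
      linarith [neg_abs_le (F.θ y t ^ r - F.θ x t ^ r)]
    have h3 := intervalIntegral.integral_mono_on (μ := volume) (by linarith : x ≤ x + 1)
      (f := fun z => |F.θx z t * r * F.θ z t ^ (r - 1)|)
      (g := fun z => r / 2 * (l * F.thermalDiss p z t + F.v z t * l⁻¹))
      (Continuous.intervalIntegrable (by fun_prop) _ _)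
      (Continuous.intervalIntegrable (by fun_prop) _ _) fun z _ => by
        have hv := F.v_pos z t
        have hz := F.θ_pos z t
        have e : F.θ z t ^ (β - p - 1) = (F.θ z t ^ (r - 1)) ^ 2 := by
          rw [← Real.rpow_natCast, ← Real.rpow_mul hz.le]
          congr 1
          push_cast
          linarith
        have hpos : 0 < F.θ z t ^ (r - 1) := by positivity
        rw [thermalDiss, e, abs_mul, abs_mul, abs_of_pos hr, abs_of_pos hpos,
          ← sq_abs (F.θx z t)]
        generalize F.θ z t ^ (r - 1) = q at *
        generalize |F.θx z t| = g at *
        generalize F.v z t = v at *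
        have h4 : r / 2 * (l * (q ^ 2 * g ^ 2 / v) + v * l⁻¹) - g * r * q
            = r / 2 * (l * q * g - v) ^ 2 / (l * v) := by
          field_simp; ring
        have h5 : 0 ≤ r / 2 * (l * q * g - v) ^ 2 / (l * v) := by positivity
        linarith
    rw [intervalIntegral.integral_const_mul,
      intervalIntegral.integral_add (Continuous.intervalIntegrable (by fun_prop) _ _)
        (Continuous.intervalIntegrable (by fun_prop) _ _), intervalIntegral.integral_const_mul,
      intervalIntegral.integral_mul_const] at h3
    refine h2.trans (h3.trans (mul_le_mul_of_nonneg_left ?_ (by positivity)))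
    rw [div_eq_mul_inv (2 * E + 2)]
    exact add_le_add (mul_le_mul_of_nonneg_left hW1 hl0.le)
      (mul_le_mul_of_nonneg_right hV (by positivity))
  have e1 : r / 2 * (l * (2 * W) + (2 * E + 2) / l) = r ^ 2 * (2 * E + 2) * W / X + X / 2 := by
    rw [hl]; field_simp
  rw [e1] at hdiff
  have h6 : X / 2 ≤ (2 * E + 3) ^ r + r ^ 2 * (2 * E + 2) * W / X := by linarith
  have h7 := mul_le_mul_of_nonneg_right h6 hX0.le
  rw [add_mul, div_mul_cancel₀ _ hX0.ne'] at h7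
  rw [hXX]
  nlinarith [sq_nonneg (X - 2 * (2 * E + 3) ^ r)]

end MHDFlow

namespace MHDFlow

variable {α β T K δ : ℝ} (F : MHDFlow α β T K δ)

lemma prod_le (hα : 0 ≤ α) {p c x t : ℝ} (hp0 : 0 < p) (hp1 : p < 1) (hc : 0 < c)
    (hcv : c ≤ F.v x t) :
    F.prod p x t ≤ 1 / 4 * (F.diss p x t - p * F.thermalDiss p x t)
      + 4 / c * ((1 + F.θ x t ^ (1 - p)) * entropy (F.θ x t)) := by
  have hv := F.v_pos x t
  have hθ := F.θ_pos x t
  have hq : 0 < F.θ x t ^ p := by positivity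
  have hvisc : 1 ≤ visc α (F.v x t) := by
    have : 0 ≤ α * F.v x t ^ (-α) := by positivity
    unfold visc; linarith
  have h1 := rpow_mul_sq_le_entropy hp0 hp1 hθ
  have h2 : 0 ≤ (1 + F.θ x t ^ (1 - p)) * entropy (F.θ x t) :=
    mul_nonneg (by positivity) (entropy_nonneg hθ)
  have h3 : F.θ x t ^ p * (F.θ x t ^ (1 - p) - 1) ^ 2 / F.v x t ≤
      4 / c * ((1 + F.θ x t ^ (1 - p)) * entropy (F.θ x t)) := by
    rw [div_mul_eq_mul_div]
    exact div_le_div₀ (by positivity) (by linarith) hc hcv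
  have h4 : F.diss p x t - p * F.thermalDiss p x t = (F.θ x t ^ p)⁻¹ *
      ((visc α (F.v x t) * F.ux x t ^ 2 + (F.w₁x x t ^ 2 + F.w₂x x t ^ 2)
      + (F.b₁x x t ^ 2 + F.b₂x x t ^ 2)) / F.v x t) := by
    rw [← Real.rpow_neg hθ.le]; unfold diss thermalDiss; ring
  have h5 : (F.θ x t ^ p)⁻¹ * (F.ux x t ^ 2 / F.v x t) ≤
      F.diss p x t - p * F.thermalDiss p x t := by
    rw [h4]
    gcongr
    have h6 := mul_le_mul_of_nonneg_right hvisc (sq_nonneg (F.ux x t))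
    have h7 : 0 ≤ F.w₁x x t ^ 2 + F.w₂x x t ^ 2 + (F.b₁x x t ^ 2 + F.b₂x x t ^ 2) := by positivity
    linarith
  have h8 : F.prod p x t ≤ 1 / 4 * ((F.θ x t ^ p)⁻¹ * (F.ux x t ^ 2 / F.v x t))
      + F.θ x t ^ p * (F.θ x t ^ (1 - p) - 1) ^ 2 / F.v x t := by
    unfold prod
    generalize F.θ x t ^ (1 - p) - 1 = y
    generalize F.θ x t ^ p = q at *
    generalize F.ux x t = g
    generalize F.v x t = v at *
    have e : 1 / 4 * (q⁻¹ * (g ^ 2 / v)) + q * y ^ 2 / v - y * g / v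
        = (g - 2 * q * y) ^ 2 / (4 * q * v) := by
      field_simp; ring
    have : 0 ≤ (g - 2 * q * y) ^ 2 / (4 * q * v) := by positivity
    linarith
  linarith

lemma exists_θ_rpow_le {α β T K δ p E : ℝ} (hp : p < β + 1) (hE : 0 < E) :
    ∃ C > 0, ∀ F : MHDFlow α β T K δ, F.EnergyBound E → ∃ R₁ ≥ 1, ∀ R ≥ R₁, ∀ t ∈ Icc 0 T, ∀ x,
      F.θ x t ^ (β - p + 1) ≤ C * (1 + ∫ z in -R..R, cutoff R z ^ 2 * F.thermalDiss p z t) := by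
  set r := (β - p + 1) / 2 with hr
  have hr0 : 0 < r := by rw [hr]; linarith
  have hrp : 2 * r = β - p + 1 := by rw [hr]; ring
  refine ⟨(3 / 2) ^ (2 * r) + 4 * ((2 * E + 3) ^ r) ^ 2 + 4 * r ^ 2 * (2 * E + 2),
    by positivity, fun F hF => ?_⟩
  obtain ⟨M, hM, hfar⟩ := F.farfield
  refine ⟨2 * (M + 1), by linarith, fun R hR t ht x => ?_⟩
  have hW : 0 ≤ ∫ z in -R..R, cutoff R z ^ 2 * F.thermalDiss p z t :=
    intervalIntegral.integral_nonneg (by linarith) fun z _ =>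
      mul_nonneg (sq_nonneg _) (F.thermalDiss_nonneg p z t)
  set W := ∫ z in -R..R, cutoff R z ^ 2 * F.thermalDiss p z t
  have q1 : (0 : ℝ) ≤ (3 / 2) ^ (2 * r) := by positivity
  have q2 : 0 ≤ 4 * ((2 * E + 3) ^ r) ^ 2 := by positivity
  have q3 : 0 ≤ 4 * r ^ 2 * (2 * E + 2) := by positivity
  have q4 := mul_nonneg (add_nonneg q1 q2) hW
  have q5 := mul_nonneg q3 hW
  rw [← hrp]
  rcases le_total M |x| with hx | hx
  · have h1 := (abs_le.1 (hfar x t hx).2.2.1).2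
    have h2 := Real.rpow_le_rpow (F.θ_pos x t).le (by linarith : F.θ x t ≤ 3 / 2)
      (by linarith : 0 ≤ 2 * r)
    linarith
  · have h1 := hF.θ_rpow_le hE hr0 hrp (by linarith : 2 * (|x| + 1) ≤ R) ht
    linarith

/-- The weighted dissipation bound, together with the pointwise control of the temperature. -/
lemma exists_thermalDiss_bound {α β T K δ p : ℝ} (hα : 0 ≤ α) (hβ : 0 < β) (hT : 0 < T)
    (hK : 0 < K) (hδ : 0 < δ) (hp0 : 0 < p) (hp1 : p < 1) :
    ∃ C > 0, ∀ F : MHDFlow α β T K δ, ∃ R₁ ≥ 1, ∀ R ≥ R₁,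
      (∫ t in (0 : ℝ)..T, ∫ z in -R..R, cutoff R z ^ 2 * F.thermalDiss p z t) ≤ C ∧
      ∀ t ∈ Icc 0 T, ∀ x, F.θ x t ^ (β - p + 1) ≤
        C * (1 + ∫ z in -R..R, cutoff R z ^ 2 * F.thermalDiss p z t) := by
  obtain ⟨E, hE, hEF⟩ := exists_energyBound (T := T) β hα hT hK hδ
  obtain ⟨c, hc, hcF⟩ := exists_lower_bound_v (K := K) (T := T) β hα hδ hE
  obtain ⟨D, hD, hDF⟩ := exists_θ_rpow_le (α := α) (T := T) (K := K) (δ := δ)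
    (by linarith : p < β + 1) hE
  obtain ⟨A, hA, hAF⟩ := exists_energy_inequality β hα hT hK hδ hp0
    (fun _ hz => hasDerivAt_thermal hp1 hz) (fun _ hz => thermal_nonneg hp0 hp1 hz)
    (fun _ hz => thermal_le hp1 hz)
  set ε := p * c / (32 * D * E) with hε
  have hε0 : 0 < ε := by positivity
  obtain ⟨N, hN, hNz⟩ := exists_rpow_le_add (by linarith : 0 < 1 - p) hβ hε0
  set B := 8 / p * (A + T * (4 / c * ((1 + N + ε * D) * E))) with hB
  have hB0 : 0 < B := by positivity
  refine ⟨B + D, by positivity, fun F => ?_⟩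
  have hF := hEF F
  obtain ⟨R₂, hR₂, hF₂⟩ := hDF F hF
  obtain ⟨R₃, hR₃, hF₃⟩ := hAF F
  obtain ⟨R₄, hR₄, hF₄⟩ := hF.weighted
  refine ⟨max R₂ (max R₃ R₄), hR₂.trans (le_max_left _ _), fun R hR => ?_⟩
  obtain ⟨hRR₂, hRR₃, hRR₄⟩ : R₂ ≤ R ∧ R₃ ≤ R ∧ R₄ ≤ R := by simpa using hR
  have hR0 : -R ≤ R := by linarith
  set W : ℝ → ℝ := fun t => ∫ z in -R..R, cutoff R z ^ 2 * F.thermalDiss p z t with hWdef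
  have hWc : Continuous W := by rw [hWdef]; fun_prop
  have hW0 (t : ℝ) : 0 ≤ W t := intervalIntegral.integral_nonneg hR0 fun z _ =>
    mul_nonneg (sq_nonneg _) (F.thermalDiss_nonneg p z t)
  have hpt := hF₂ R hRR₂
  constructor
  swap
  · intro t ht x
    refine (hpt t ht x).trans (mul_le_mul_of_nonneg_right (by linarith) ?_)
    have := hW0 t
    linarith
  have hTT : T ∈ Icc 0 T := ⟨hT.le, le_rfl⟩
  have hprod : ∀ s ∈ Icc 0 T, ∫ x in -R..R, cutoff R x ^ 2 * F.prod p x s ≤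
      1 / 4 * (∫ x in -R..R, cutoff R x ^ 2 * F.diss p x s) - p / 8 * W s
        + 4 / c * ((1 + N + ε * D) * E) := by
    intro s hs
    have h1 := intervalIntegral.integral_mono_on (μ := volume) hR0
      (f := fun x => cutoff R x ^ 2 * F.prod p x s)
      (g := fun x => 1 / 4 * (cutoff R x ^ 2 * F.diss p x s)
        - p / 4 * (cutoff R x ^ 2 * F.thermalDiss p x s)
        + 4 / c * (1 + N + ε * (D * (1 + W s))) * (cutoff R x ^ 2 * F.energy entropy x s))
      (Continuous.intervalIntegrable (by fun_prop) _ _)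
      (Continuous.intervalIntegrable (by fun_prop) _ _) fun x _ => by
        have hθ := F.θ_pos x s
        have h2 := F.prod_le hα hp0 hp1 hc (hcF F hF x s hs)
        have h3 : F.θ x s ^ (1 - p) ≤ N + ε * (D * (1 + W s)) := by
          refine (hNz _ hθ).trans ?_
          rw [show 1 - p + β = β - p + 1 by ring]
          have := mul_le_mul_of_nonneg_left (hpt s hs x) hε0.le
          linarith
        have h4 : (1 + F.θ x s ^ (1 - p)) * entropy (F.θ x s) ≤
            (1 + N + ε * (D * (1 + W s))) * F.energy entropy x s :=
          mul_le_mul (by linarith) (F.entropy_θ_le x s) (entropy_nonneg hθ)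
            (by have := hW0 s; positivity)
        have h5 := mul_le_mul_of_nonneg_left h4 (by positivity : 0 ≤ 4 / c)
        have h6 := mul_le_mul_of_nonneg_left (h2.trans (add_le_add_right h5 _))
          (sq_nonneg (cutoff R x))
        linarith
    rw [intervalIntegral.integral_add (Continuous.intervalIntegrable (by fun_prop) _ _)
        (Continuous.intervalIntegrable (by fun_prop) _ _),
      intervalIntegral.integral_sub (Continuous.intervalIntegrable (by fun_prop) _ _)
        (Continuous.intervalIntegrable (by fun_prop) _ _), intervalIntegral.integral_const_mul,
      intervalIntegral.integral_const_mul, intervalIntegral.integral_const_mul] at h1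
    have h2 := mul_le_mul_of_nonneg_left (hF₄ R hRR₄ s hs)
      (by have := hW0 s; positivity : 0 ≤ 4 / c * (1 + N + ε * (D * (1 + W s))))
    have e : 4 / c * (1 + N + ε * (D * (1 + W s))) * E
        = 4 / c * ((1 + N + ε * D) * E) + p / 8 * W s := by
      have e' : 4 / c * (ε * D * E) = p / 8 := by rw [hε]; field_simp; norm_num
      linear_combination W s * e'
    have e2 : ∫ x in -R..R, cutoff R x ^ 2 * F.thermalDiss p x s = W s := rfl
    rw [e2] at h1
    linarith
  have h1 := intervalIntegral.integral_mono_on (μ := volume) hT.le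
    (Continuous.intervalIntegrable (by fun_prop) _ _)
    (Continuous.intervalIntegrable (by fun_prop) _ _) hprod
  rw [intervalIntegral.integral_add (Continuous.intervalIntegrable (by fun_prop) _ _)
      (Continuous.intervalIntegrable (by fun_prop) _ _),
    intervalIntegral.integral_sub (Continuous.intervalIntegrable (by fun_prop) _ _)
      (Continuous.intervalIntegrable (by fun_prop) _ _), intervalIntegral.integral_const_mul,
    intervalIntegral.integral_const_mul, intervalIntegral.integral_const, smul_eq_mul] at h1
  have h2 := hF₃ R hRR₃ T hTT
  have h3 : 0 ≤ ∫ x in -R..R, cutoff R x ^ 2 * F.energy (thermal p) x T :=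
    intervalIntegral.integral_nonneg hR0 fun x _ => mul_nonneg (sq_nonneg _)
      (F.energy_nonneg (fun _ hz => thermal_nonneg hp0 hp1 hz) x T)
  have h4 : 0 ≤ ∫ s in (0 : ℝ)..T, ∫ x in -R..R, cutoff R x ^ 2 * F.diss p x s :=
    intervalIntegral.integral_nonneg hT.le fun s _ =>
      intervalIntegral.integral_nonneg hR0 fun x _ =>
        mul_nonneg (sq_nonneg _) (F.diss_nonneg hα hp0.le x s)
  have h5 : p / 8 * ∫ s in (0 : ℝ)..T, W s ≤ A + T * (4 / c * ((1 + N + ε * D) * E)) := by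
    linarith
  have h6 := mul_le_mul_of_nonneg_left h5 (by positivity : 0 ≤ 8 / p)
  have e : 8 / p * (p / 8 * ∫ s in (0 : ℝ)..T, W s) = ∫ s in (0 : ℝ)..T, W s := by field_simp
  rw [e] at h6
  linarith

end MHDFlow

lemma HasDerivAt.fst_real {f : ℝ → ℝ × ℝ} {f' : ℝ × ℝ} {x : ℝ} (h : HasDerivAt f f' x) :
    HasDerivAt (fun y => (f y).1) f'.1 x :=
  (ContinuousLinearMap.fst ℝ ℝ ℝ).hasFDerivAt.comp_hasDerivAt x h

lemma HasDerivAt.snd_real {f : ℝ → ℝ × ℝ} {f' : ℝ × ℝ} {x : ℝ} (h : HasDerivAt f f' x) :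
    HasDerivAt (fun y => (f y).2) f'.2 x :=
  (ContinuousLinearMap.snd ℝ ℝ ℝ).hasFDerivAt.comp_hasDerivAt x h

/-- The projection of the real line onto `[0, T]`. -/
def clampTime (T t : ℝ) : ℝ := max 0 (min T t)

lemma clampTime_mem {T : ℝ} (hT : 0 < T) (t : ℝ) : clampTime T t ∈ Icc 0 T :=
  ⟨le_max_left _ _, max_le hT.le (min_le_left _ _)⟩

lemma clampTime_of_mem {T t : ℝ} (ht : t ∈ Icc 0 T) : clampTime T t = t := by
  rw [clampTime, min_eq_right ht.2, max_eq_right ht.1]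

lemma continuous_comp_clampTime {E : Type*} [TopologicalSpace E] {T : ℝ} (hT : 0 < T)
    {g : ℝ × ℝ → E} (hg : ContinuousOn g (univ ×ˢ Icc 0 T)) :
    Continuous fun p : ℝ × ℝ => g (p.1, clampTime T p.2) :=
  hg.comp_continuous (f := fun p : ℝ × ℝ => (p.1, clampTime T p.2))
    (by unfold clampTime; fun_prop) fun p => ⟨mem_univ _, clampTime_mem hT p.2⟩

lemma hasDerivAt_comp_clampTime {E : Type*} [NormedAddCommGroup E] [NormedSpace ℝ E] {T t : ℝ}
    (ht : t ∈ Ioo 0 T) {f : ℝ → E} (hf : DifferentiableWithinAt ℝ f (Icc 0 T) t) :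
    HasDerivAt (fun s => f (clampTime T s)) (derivWithin f (Icc 0 T) (clampTime T t)) t := by
  have h := hf.hasDerivWithinAt.hasDerivAt (Icc_mem_nhds ht.1 ht.2)
  rw [clampTime_of_mem ⟨ht.1.le, ht.2.le⟩]
  refine h.congr_of_eventuallyEq ?_
  filter_upwards [Icc_mem_nhds ht.1 ht.2] with s hs
  rw [clampTime_of_mem hs]

lemma intervalIntegral_le_integral_of_le {f g : ℝ → ℝ} (hf : Continuous f) (hg : Integrable g)
    (hg₀ : ∀ x, 0 ≤ g x) (h : ∀ x, f x ≤ g x) {a b : ℝ} (hab : a ≤ b) :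
    ∫ x in a..b, f x ≤ ∫ x, g x := by
  refine (intervalIntegral.integral_mono_on hab (hf.intervalIntegrable _ _)
    hg.intervalIntegrable fun x _ => h x).trans ?_
  rw [intervalIntegral.integral_of_le hab]
  exact setIntegral_le_integral hg (Filter.Eventually.of_forall hg₀)

lemma abs_le_of_local_sobolev {f f' : ℝ → ℝ} {K : ℝ} (hK : 0 < K)
    (hd : ∀ x, HasDerivAt f (f' x) x) (hf' : Continuous f') {x : ℝ}
    (h : ∫ y in x..x + 1, (f y ^ 2 + f' y ^ 2) ≤ K ^ 2) : |f x| ≤ 2 * K := by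
  have hf : Continuous f := continuous_iff_continuousAt.2 fun y => (hd y).continuousAt
  have h1 : ∀ y ∈ Icc x (x + 1), |f x| ≤ |f y| + ∫ z in x..x + 1, |f' z| := by
    intro y hy
    have h2 := intervalIntegral.integral_eq_sub_of_hasDerivAt (a := x) (b := y)
      (fun z _ => hd z) (hf'.intervalIntegrable _ _)
    have h3 := (intervalIntegral.abs_integral_le_integral_abs (μ := volume) (f := f') hy.1).trans
      (intervalIntegral.integral_mono_interval (f := fun z => |f' z|) le_rfl hy.1 hy.2
        (Filter.Eventually.of_forall fun y => abs_nonneg _) (hf'.abs.intervalIntegrable _ _))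
    rw [h2] at h3
    have h4 := abs_sub_abs_le_abs_sub (f x) (f y)
    rw [abs_sub_comm] at h4
    linarith
  have h2 := intervalIntegral.integral_mono_on (μ := volume) (by linarith : x ≤ x + 1)
    (Continuous.intervalIntegrable (by fun_prop) _ _)
    (Continuous.intervalIntegrable (by fun_prop) _ _) h1
  rw [intervalIntegral.integral_add (Continuous.intervalIntegrable (by fun_prop) _ _)
    (Continuous.intervalIntegrable (by fun_prop) _ _), intervalIntegral.integral_const,
    intervalIntegral.integral_const, smul_eq_mul, smul_eq_mul,
    ← one_mul (∫ z in x..x + 1, |f' z|)] at h2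
  have h3 := intervalIntegral.integral_mono_on (μ := volume) (by linarith : x ≤ x + 1)
    (f := fun y => |f y| + |f' y|) (g := fun y => K + 1 / (2 * K) * (f y ^ 2 + f' y ^ 2))
    (Continuous.intervalIntegrable (by fun_prop) _ _)
    (Continuous.intervalIntegrable (by fun_prop) _ _) fun y _ => by
      have key (a : ℝ) : |a| ≤ K / 2 + 1 / (2 * K) * a ^ 2 := by
        have e : K / 2 + 1 / (2 * K) * a ^ 2 - |a| = (|a| - K) ^ 2 / (2 * K) := by
          rw [← sq_abs a]; field_simp; ring
        have : 0 ≤ (|a| - K) ^ 2 / (2 * K) := by positivity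
        linarith
      linarith [key (f y), key (f' y)]
  rw [intervalIntegral.integral_add (Continuous.intervalIntegrable (by fun_prop) _ _)
    (Continuous.intervalIntegrable (by fun_prop) _ _),
    intervalIntegral.integral_add (Continuous.intervalIntegrable (by fun_prop) _ _)
    (Continuous.intervalIntegrable (by fun_prop) _ _), intervalIntegral.integral_const,
    intervalIntegral.integral_const_mul, smul_eq_mul] at h3
  have h4 := mul_le_mul_of_nonneg_left h (by positivity : 0 ≤ 1 / (2 * K))
  have e : 1 / (2 * K) * K ^ 2 = K / 2 := by field_simp
  linarith

lemma sq2_nonneg (p : ℝ × ℝ) : 0 ≤ sq2 p := by unfold sq2; positivity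

lemma abs_fst_le_sqrt_sq2 (p : ℝ × ℝ) : |p.1| ≤ √(sq2 p) :=
  Real.abs_le_sqrt (by unfold sq2; nlinarith [sq_nonneg p.2])

lemma abs_snd_le_sqrt_sq2 (p : ℝ × ℝ) : |p.2| ≤ √(sq2 p) :=
  Real.abs_le_sqrt (by unfold sq2; nlinarith [sq_nonneg p.1])

namespace IsClassicalSolution

variable {α β T K δ : ℝ} {v u θ : ℝ → ℝ → ℝ} {w b : ℝ → ℝ → ℝ × ℝ}

lemma hasDerivAt_momentum (h : IsClassicalSolution α β T v u θ w b) (x : ℝ) {t : ℝ}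
    (ht : t ∈ Icc 0 T) :
    HasDerivAt (fun y => visc α (v y t) * pdx u y t / v y t - (θ y t / v y t + sq2 (b y t) / 2))
      (pdt T u x t) x := by
  have hv := (h.v_pos x t ht).ne'
  obtain ⟨dv, _, dθ, _, db⟩ := h.diff_x x t ht
  have dux := (h.diff_xx x t ht).1
  have d1 : DifferentiableAt ℝ (fun y => visc α (v y t) * pdx u y t / v y t) x := by
    unfold visc
    exact (((dv.rpow_const (Or.inl hv)).const_mul α).const_add 1 |>.mul dux).div dv hv
  have d2 : DifferentiableAt ℝ (fun y => θ y t / v y t + sq2 (b y t) / 2) x := by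
    unfold sq2
    exact (dθ.div dv hv).add (((db.fst.pow 2).add (db.snd.pow 2)).div_const 2)
  refine (d1.hasDerivAt.sub d2.hasDerivAt).congr_deriv ?_
  have := h.eq_mom x t ht
  simp only [pdx] at this ⊢
  linarith

lemma hasDerivAt_transverse (h : IsClassicalSolution α β T v u θ w b) (x : ℝ) {t : ℝ}
    (ht : t ∈ Icc 0 T) :
    HasDerivAt (fun y => (v y t)⁻¹ • pdx w y t) (pdt T w x t - pdx b x t) x := by
  have hv := (h.v_pos x t ht).ne'
  rw [h.eq_w x t ht]
  exact (((h.diff_x x t ht).1.inv hv).smul (h.diff_xx x t ht).2.2.1).hasDerivAt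

lemma hasDerivAt_magnetic (h : IsClassicalSolution α β T v u θ w b) (x : ℝ) {t : ℝ}
    (ht : t ∈ Icc 0 T) :
    HasDerivAt (fun y => (v y t)⁻¹ • pdx b y t)
      (pdx u x t • b x t + v x t • pdt T b x t - pdx w x t) x := by
  have hv := (h.v_pos x t ht).ne'
  have e : pdt T (fun y s => v y s • b y s) x t = v x t • pdt T b x t + pdt T v x t • b x t :=
    derivWithin_fun_smul (h.diff_t x t ht).1 (h.diff_t x t ht).2.2.2.2
  rw [← h.eq_mass x t ht, add_comm (pdt T v x t • b x t), ← e, h.eq_b x t ht]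
  exact (((h.diff_x x t ht).1.inv hv).smul (h.diff_xx x t ht).2.2.2).hasDerivAt

lemma hasDerivAt_temperature (h : IsClassicalSolution α β T v u θ w b) (x : ℝ) {t : ℝ}
    (ht : t ∈ Icc 0 T) :
    HasDerivAt (fun y => θ y t ^ β * pdx θ y t / v y t)
      (pdt T θ x t + θ x t / v x t * pdx u x t
        - (visc α (v x t) * pdx u x t ^ 2 + sq2 (pdx w x t) + sq2 (pdx b x t)) / v x t) x := by
  have hv := (h.v_pos x t ht).ne'
  have hθ := (h.θ_pos x t ht).ne'
  obtain ⟨dv, _, dθ, _⟩ := h.diff_x x t ht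
  rw [h.eq_temp x t ht, add_sub_cancel_right]
  exact (((dθ.rpow_const (Or.inl hθ)).mul (h.diff_xx x t ht).2.1).div dv hv).hasDerivAt

lemma intervalIntegral_initial_le (h : IsClassicalSolution α β T v u θ w b) (hT : 0 < T)
    (hadm : Admissible K δ v u θ w b) {f : ℝ → ℝ} (hf : Continuous f)
    (hle : ∀ x, f x ≤ (v x 0 - 1) ^ 2 + (u x 0) ^ 2 + (θ x 0 - 1) ^ 2 + sq2 (b x 0) + sq2 (w x 0)
      + (pdx v x 0) ^ 2) {a c : ℝ} (hac : a ≤ c) : ∫ x in a..c, f x ≤ K ^ 2 := by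
  obtain ⟨i1, i2, i3, i4, i5, i6, i7, i8, i9, i10⟩ := h.sq_int 0 ⟨le_rfl, hT.le⟩
  refine (intervalIntegral_le_integral_of_le hf
    (((((((((i1.add i2).add i3).add i4).add i5).add i6).add i7).add i8).add i9).add i10)
    (fun x => ?_) (fun x => ?_) hac).trans hadm.1
  all_goals
    have h4 := sq2_nonneg (b x 0)
    have h5 := sq2_nonneg (w x 0)
    have h9 := sq2_nonneg (pdx b x 0)
    have h10 := sq2_nonneg (pdx w x 0)
    simp only [Pi.add_apply]
  · positivity
  · have := hle x
    have : 0 ≤ pdx u x 0 ^ 2 + pdx θ x 0 ^ 2 := by positivity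
    linarith

lemma initial_v_le (h : IsClassicalSolution α β T v u θ w b) (hT : 0 < T) (hK : 0 < K)
    (hadm : Admissible K δ v u θ w b) (x : ℝ) : v x 0 ≤ 1 + 2 * K := by
  have h0 : (0 : ℝ) ∈ Icc 0 T := ⟨le_rfl, hT.le⟩
  have hd (y : ℝ) : HasDerivAt (fun y => v y 0 - 1) (pdx v y 0) y :=
    (h.diff_x y 0 h0).1.hasDerivAt.sub_const 1
  have hc : Continuous fun y => pdx v y 0 := h.cont_dx.fst.comp_continuous
    (f := fun y : ℝ => (y, (0 : ℝ))) (by fun_prop) fun y => ⟨mem_univ _, h0⟩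
  have hcv : Continuous fun y => v y 0 - 1 :=
    continuous_iff_continuousAt.2 fun y => (hd y).continuousAt
  have := abs_le_of_local_sobolev hK hd hc (x := x)
    (h.intervalIntegral_initial_le hT hadm (by fun_prop) (fun y => by
      have h4 := sq2_nonneg (b y 0)
      have h5 := sq2_nonneg (w y 0)
      have : 0 ≤ u y 0 ^ 2 + (θ y 0 - 1) ^ 2 := by positivity
      linarith) (by linarith))
  linarith [(abs_le.1 this).2]

/-- The flow associated with a classical solution with admissible data. -/
def toFlow (h : IsClassicalSolution α β T v u θ w b) (hT : 0 < T) (hK : 0 < K)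
    (hadm : Admissible K δ v u θ w b) : MHDFlow α β T K δ where
  v x t := v x (clampTime T t)
  u x t := u x (clampTime T t)
  θ x t := θ x (clampTime T t)
  w₁ x t := (w x (clampTime T t)).1
  w₂ x t := (w x (clampTime T t)).2
  b₁ x t := (b x (clampTime T t)).1
  b₂ x t := (b x (clampTime T t)).2
  ux x t := pdx u x (clampTime T t)
  θx x t := pdx θ x (clampTime T t)
  w₁x x t := (pdx w x (clampTime T t)).1
  w₂x x t := (pdx w x (clampTime T t)).2
  b₁x x t := (pdx b x (clampTime T t)).1
  b₂x x t := (pdx b x (clampTime T t)).2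
  ut x t := pdt T u x (clampTime T t)
  θt x t := pdt T θ x (clampTime T t)
  w₁t x t := (pdt T w x (clampTime T t)).1
  w₂t x t := (pdt T w x (clampTime T t)).2
  b₁t x t := (pdt T b x (clampTime T t)).1
  b₂t x t := (pdt T b x (clampTime T t)).2
  v_pos x t := h.v_pos x _ (clampTime_mem hT t)
  θ_pos x t := h.θ_pos x _ (clampTime_mem hT t)
  cont_v := (continuous_comp_clampTime hT h.cont).fst
  cont_u := (continuous_comp_clampTime hT h.cont).snd.fst
  cont_θ := (continuous_comp_clampTime hT h.cont).snd.snd.fst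
  cont_w₁ := (continuous_comp_clampTime hT h.cont).snd.snd.snd.fst.fst
  cont_w₂ := (continuous_comp_clampTime hT h.cont).snd.snd.snd.fst.snd
  cont_b₁ := (continuous_comp_clampTime hT h.cont).snd.snd.snd.snd.fst
  cont_b₂ := (continuous_comp_clampTime hT h.cont).snd.snd.snd.snd.snd
  cont_ux := (continuous_comp_clampTime hT h.cont_dx).snd.fst
  cont_θx := (continuous_comp_clampTime hT h.cont_dx).snd.snd.fst
  cont_w₁x := (continuous_comp_clampTime hT h.cont_dx).snd.snd.snd.fst.fst
  cont_w₂x := (continuous_comp_clampTime hT h.cont_dx).snd.snd.snd.fst.snd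
  cont_b₁x := (continuous_comp_clampTime hT h.cont_dx).snd.snd.snd.snd.fst
  cont_b₂x := (continuous_comp_clampTime hT h.cont_dx).snd.snd.snd.snd.snd
  cont_ut := (continuous_comp_clampTime hT h.cont_dt).snd.fst
  cont_θt := (continuous_comp_clampTime hT h.cont_dt).snd.snd.fst
  cont_w₁t := (continuous_comp_clampTime hT h.cont_dt).snd.snd.snd.fst.fst
  cont_w₂t := (continuous_comp_clampTime hT h.cont_dt).snd.snd.snd.fst.snd
  cont_b₁t := (continuous_comp_clampTime hT h.cont_dt).snd.snd.snd.snd.fst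
  cont_b₂t := (continuous_comp_clampTime hT h.cont_dt).snd.snd.snd.snd.snd
  deriv_u x t := (h.diff_x x _ (clampTime_mem hT t)).2.1.hasDerivAt
  deriv_θ x t := (h.diff_x x _ (clampTime_mem hT t)).2.2.1.hasDerivAt
  deriv_w₁ x t := (h.diff_x x _ (clampTime_mem hT t)).2.2.2.1.hasDerivAt.fst_real
  deriv_w₂ x t := (h.diff_x x _ (clampTime_mem hT t)).2.2.2.1.hasDerivAt.snd_real
  deriv_b₁ x t := (h.diff_x x _ (clampTime_mem hT t)).2.2.2.2.hasDerivAt.fst_real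
  deriv_b₂ x t := (h.diff_x x _ (clampTime_mem hT t)).2.2.2.2.hasDerivAt.snd_real
  time_v x t ht := by
    rw [← h.eq_mass x _ (clampTime_mem hT t)]
    exact hasDerivAt_comp_clampTime ht (h.diff_t x t (Ioo_subset_Icc_self ht)).1
  time_u x t ht := hasDerivAt_comp_clampTime ht (h.diff_t x t (Ioo_subset_Icc_self ht)).2.1
  time_θ x t ht := hasDerivAt_comp_clampTime ht (h.diff_t x t (Ioo_subset_Icc_self ht)).2.2.1
  time_w₁ x t ht :=
    (hasDerivAt_comp_clampTime ht (h.diff_t x t (Ioo_subset_Icc_self ht)).2.2.2.1).fst_real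
  time_w₂ x t ht :=
    (hasDerivAt_comp_clampTime ht (h.diff_t x t (Ioo_subset_Icc_self ht)).2.2.2.1).snd_real
  time_b₁ x t ht :=
    (hasDerivAt_comp_clampTime ht (h.diff_t x t (Ioo_subset_Icc_self ht)).2.2.2.2).fst_real
  time_b₂ x t ht :=
    (hasDerivAt_comp_clampTime ht (h.diff_t x t (Ioo_subset_Icc_self ht)).2.2.2.2).snd_real
  momentum x t := h.hasDerivAt_momentum x (clampTime_mem hT t)
  transverse₁ x t := (h.hasDerivAt_transverse x (clampTime_mem hT t)).fst_real
  transverse₂ x t := (h.hasDerivAt_transverse x (clampTime_mem hT t)).snd_real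
  magnetic₁ x t := (h.hasDerivAt_magnetic x (clampTime_mem hT t)).fst_real
  magnetic₂ x t := (h.hasDerivAt_magnetic x (clampTime_mem hT t)).snd_real
  temperature x t := h.hasDerivAt_temperature x (clampTime_mem hT t)
  farfield := by
    obtain ⟨M, hM⟩ := h.farfield (1 / 2) (by norm_num)
    refine ⟨max M 1, by positivity, fun x t hx => ?_⟩
    obtain ⟨hv, hu, hθ, hb, hw⟩ := hM x _ (clampTime_mem hT t) ((le_max_left _ _).trans hx)
    exact ⟨hv.le, hu.le, hθ.le, (abs_fst_le_sqrt_sq2 _).trans hw.le,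
      (abs_snd_le_sqrt_sq2 _).trans hw.le, (abs_fst_le_sqrt_sq2 _).trans hb.le,
      (abs_snd_le_sqrt_sq2 _).trans hb.le⟩
  init_v x := by
    rw [clampTime_of_mem ⟨le_rfl, hT.le⟩]
    exact ⟨hadm.2.1 x, h.initial_v_le hT hK hadm x⟩
  init_θ x := by
    rw [clampTime_of_mem ⟨le_rfl, hT.le⟩]
    exact hadm.2.2 x
  init_int R hR := by
    have hc : Continuous fun x : ℝ => (v x (clampTime T 0), u x (clampTime T 0),
        θ x (clampTime T 0), w x (clampTime T 0), b x (clampTime T 0)) :=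
      (continuous_comp_clampTime hT h.cont).comp
        (by fun_prop : Continuous fun x : ℝ => (x, (0 : ℝ)))
    rw [clampTime_of_mem ⟨le_rfl, hT.le⟩] at hc ⊢
    have h1 := hc.fst
    have h2 := hc.snd.fst
    have h3 := hc.snd.snd.fst
    have h4 := hc.snd.snd.snd.fst
    have h5 := hc.snd.snd.snd.snd
    refine h.intervalIntegral_initial_le hT hadm (by fun_prop) (fun x => ?_) (by linarith)
    have : 0 ≤ pdx v x 0 ^ 2 := sq_nonneg _
    unfold sq2
    linarith

end IsClassicalSolution

lemma integral_integral_le_of_exhaustion {G : ℝ → ℝ → ℝ} {T C : ℝ}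
    (hG : Continuous fun p : ℝ × ℝ => G p.1 p.2) (hG0 : ∀ x t, 0 ≤ G x t) (hT : 0 ≤ T) (hC : 0 ≤ C)
    (h : ∀ n : ℕ, ∫ t in (0 : ℝ)..T, ∫ x in -(n : ℝ)..n, G x t ≤ C) :
    ∫ t in (0 : ℝ)..T, ∫ x, G x t ≤ C := by
  have hcx (t : ℝ) : Continuous fun x => G x t := hG.comp (by fun_prop : Continuous fun x => (x, t))
  have hct (n : ℕ) : Continuous fun t => ∫ x in -(n : ℝ)..n, G x t :=
    intervalIntegral.continuous_parametric_intervalIntegral_of_continuous'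
      (f := fun t x => G x t) (hG.comp continuous_swap) _ _
  have hn (n : ℕ) : -(n : ℝ) ≤ n := by linarith [n.cast_nonneg (α := ℝ)]
  have h0 (n : ℕ) (t : ℝ) : 0 ≤ ∫ x in -(n : ℝ)..n, G x t :=
    intervalIntegral.integral_nonneg (hn n) fun x _ => hG0 x t
  have hsup (t : ℝ) : ∫⁻ x, ‖G x t‖ₑ = ⨆ n : ℕ, ENNReal.ofReal (∫ x in -(n : ℝ)..n, G x t) := by
    rw [← (aecover_Ioc (μ := volume) (tendsto_neg_atTop_atBot.comp tendsto_natCast_atTop_atTop)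
      tendsto_natCast_atTop_atTop).iSup_lintegral_eq_of_countably_generated
      (hcx t).enorm.aemeasurable]
    refine iSup_congr fun n => ?_
    rw [intervalIntegral.integral_of_le (hn n), ofReal_integral_eq_lintegral_ofReal
      ((hcx t).integrableOn_Ioc) (ae_of_all _ fun x => hG0 x t)]
    exact lintegral_congr fun x => Real.enorm_eq_ofReal (hG0 x t)
  have hmono (t : ℝ) : Monotone fun n : ℕ => ∫ x in -(n : ℝ)..n, G x t := fun m n hmn =>
    have hmn' : (m : ℝ) ≤ n := Nat.cast_le.2 hmn
    intervalIntegral.integral_mono_interval (neg_le_neg hmn') (hn m) hmn'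
      (ae_of_all _ fun x => hG0 x t) ((hcx t).intervalIntegrable _ _)
  rw [intervalIntegral.integral_of_le hT]
  refine (Real.le_norm_self _).trans ?_
  rw [← toReal_enorm]
  refine ENNReal.toReal_le_of_le_ofReal hC ?_
  calc ‖∫ t in Ioc 0 T, ∫ x, G x t‖ₑ
      ≤ ∫⁻ t in Ioc 0 T, ⨆ n : ℕ, ENNReal.ofReal (∫ x in -(n : ℝ)..n, G x t) := by
        refine (enorm_integral_le_lintegral_enorm _).trans (lintegral_mono fun t => ?_)
        rw [← hsup]
        exact enorm_integral_le_lintegral_enorm _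
    _ = ⨆ n : ℕ, ∫⁻ t in Ioc 0 T, ENNReal.ofReal (∫ x in -(n : ℝ)..n, G x t) :=
        lintegral_iSup (fun n => (hct n).measurable.ennreal_ofReal)
          fun m n hmn t => ENNReal.ofReal_le_ofReal (hmono t hmn)
    _ ≤ ENNReal.ofReal C := iSup_le fun n => by
        rw [← ofReal_integral_eq_lintegral_ofReal (hct n).integrableOn_Ioc
          (ae_of_all _ (h0 n)), ← intervalIntegral.integral_of_le hT]
        exact ENNReal.ofReal_le_ofReal (h n)

namespace MHDFlow

variable {α β T K δ : ℝ} (F : MHDFlow α β T K δ)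

lemma integral_thermalDiss_le {p C R₁ : ℝ} (hT : 0 ≤ T) (hC : 0 ≤ C) (hR₁ : 1 ≤ R₁)
    (h : ∀ R ≥ R₁,
      (∫ t in (0 : ℝ)..T, ∫ z in -R..R, cutoff R z ^ 2 * F.thermalDiss p z t) ≤ C) :
    ∫ t in (0 : ℝ)..T, ∫ x, F.thermalDiss p x t ≤ 2 * C := by
  refine integral_integral_le_of_exhaustion (by fun_prop) (F.thermalDiss_nonneg p) hT
    (by linarith) fun n => ?_
  have hn : (0 : ℝ) ≤ n := n.cast_nonneg
  set R := max R₁ (2 * n) with hR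
  have hR1 : R₁ ≤ R := le_max_left _ _
  have hR2 : 2 * (n : ℝ) ≤ R := le_max_right _ _
  refine le_trans ?_ (mul_le_mul_of_nonneg_left (h R hR1) zero_le_two)
  rw [← intervalIntegral.integral_const_mul]
  refine intervalIntegral.integral_mono_on hT (Continuous.intervalIntegrable (by fun_prop) _ _)
    (Continuous.intervalIntegrable (by fun_prop) _ _) fun t _ => ?_
  rw [← intervalIntegral.integral_const_mul]
  calc ∫ x in -(n : ℝ)..n, F.thermalDiss p x t
      ≤ ∫ x in -(n : ℝ)..n, 2 * (cutoff R x ^ 2 * F.thermalDiss p x t) := by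
        refine intervalIntegral.integral_mono_on (by linarith)
          (Continuous.intervalIntegrable (by fun_prop) _ _)
          (Continuous.intervalIntegrable (by fun_prop) _ _) fun x hx => ?_
        have h1 := one_half_le_cutoff_sq (R := R) (x := x) (by linarith)
          (by linarith [abs_le.2 ⟨hx.1, hx.2⟩])
        nlinarith [F.thermalDiss_nonneg p x t]
    _ ≤ ∫ x in -R..R, 2 * (cutoff R x ^ 2 * F.thermalDiss p x t) :=
        intervalIntegral.integral_mono_interval (by linarith) (by linarith) (by linarith)
          (ae_of_all _ fun x => mul_nonneg zero_le_two
            (mul_nonneg (sq_nonneg _) (F.thermalDiss_nonneg p x t)))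
          (Continuous.intervalIntegrable (by fun_prop) _ _)

lemma integral_iSup_θ_le {p C R : ℝ} (hT : 0 ≤ T) (hC : 0 ≤ C) (hp : p ≤ β)
    (hI : (∫ t in (0 : ℝ)..T, ∫ z in -R..R, cutoff R z ^ 2 * F.thermalDiss p z t) ≤ C)
    (hθ : ∀ t ∈ Icc 0 T, ∀ x, F.θ x t ^ (β - p + 1) ≤
      C * (1 + ∫ z in -R..R, cutoff R z ^ 2 * F.thermalDiss p z t)) :
    ∫ t in (0 : ℝ)..T, ⨆ x, F.θ x t ≤ T * (1 + C) + C * C := by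
  set W : ℝ → ℝ := fun t => ∫ z in -R..R, cutoff R z ^ 2 * F.thermalDiss p z t with hW
  have hWc : Continuous W := by fun_prop
  have hle : ∀ t ∈ Icc 0 T, ⨆ x, F.θ x t ≤ 1 + C * (1 + W t) := fun t ht =>
    ciSup_le fun x => by
      have hx := F.θ_pos x t
      have h1 := hθ t ht x
      rcases le_total (F.θ x t) 1 with h | h
      · linarith [Real.rpow_nonneg hx.le (β - p + 1)]
      · have := Real.rpow_le_rpow_of_exponent_le h (by linarith : (1 : ℝ) ≤ β - p + 1)
        rw [Real.rpow_one] at this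
        linarith
  calc ∫ t in (0 : ℝ)..T, ⨆ x, F.θ x t ≤ ∫ t in (0 : ℝ)..T, (1 + C * (1 + W t)) := by
        rw [intervalIntegral.integral_of_le hT, intervalIntegral.integral_of_le hT]
        refine integral_mono_of_nonneg
          (ae_of_all _ fun t => Real.iSup_nonneg fun x => (F.θ_pos x t).le)
          (Continuous.integrableOn_Ioc (by fun_prop)) ?_
        filter_upwards [ae_restrict_mem measurableSet_Ioc] with t ht
        exact hle t (Ioc_subset_Icc_self ht)
    _ = T * (1 + C) + C * ∫ t in (0 : ℝ)..T, W t := by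
        have e : (fun t => 1 + C * (1 + W t)) = fun t => (1 + C) + C * W t := by
          ext t; ring
        rw [e, intervalIntegral.integral_add (by simp)
          (Continuous.intervalIntegrable (by fun_prop) _ _), intervalIntegral.integral_const_mul]
        simp only [intervalIntegral.integral_const, smul_eq_mul, sub_zero]
    _ ≤ T * (1 + C) + C * C := by gcongr

end MHDFlow

/-- (2.20) and (2.21) of the paper: with `η := max{1, 2−β}/4`, the time
integral of `sup_x θ` and the weighted Dirichlet integral of `θ` are bounded by a constant
depending only on `T, α, β, K, δ`. -/
theorem sup_theta_time_integrable (α β T K δ : ℝ) (hα : 0 ≤ α) (hβ : 0 < β) (hT : 0 < T)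
    (hK : 0 < K) (hδ₀ : 0 < δ) (hδ₁ : δ ≤ 1) :
    ∃ C : ℝ, 0 < C ∧
      ∀ (v u θ : ℝ → ℝ → ℝ) (w b : ℝ → ℝ → ℝ × ℝ),
        IsClassicalSolution α β T v u θ w b → Admissible K δ v u θ w b →
        (∫ t in (0:ℝ)..T, ⨆ x : ℝ, θ x t) ≤ C ∧
        (∫ t in (0:ℝ)..T, ∫ x : ℝ,
            θ x t ^ (β + 2 * (max 1 (2 - β) / 4) - 2) * (pdx θ x t) ^ 2 / v x t) ≤ C := by
  set p := 1 - max 1 (2 - β) / 2 with hp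
  have hm1 : 1 ≤ max 1 (2 - β) := le_max_left _ _
  have hm2 : 2 - β ≤ max 1 (2 - β) := le_max_right _ _
  have hm3 : max 1 (2 - β) < 2 := max_lt one_lt_two (by linarith)
  have hp0 : 0 < p := by linarith
  have hp1 : p < 1 := by linarith
  obtain ⟨C, hC, hCF⟩ := MHDFlow.exists_thermalDiss_bound hα hβ hT hK hδ₀ hp0 hp1
  refine ⟨T * (1 + C) + C * C + 2 * C, by positivity, fun v u θ w b h hadm => ?_⟩
  set F := h.toFlow hT hK hadm with hF
  obtain ⟨R₁, hR₁, hR⟩ := hCF F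
  have hsup := F.integral_iSup_θ_le hT.le hC.le (by linarith) (hR R₁ le_rfl).1 (hR R₁ le_rfl).2
  have hdiss := F.integral_thermalDiss_le hT.le hC.le hR₁ fun R hR' => (hR R hR').1
  have hclamp : ∀ t ∈ uIcc 0 T, clampTime T t = t := fun t ht =>
    clampTime_of_mem (by rwa [uIcc_of_le hT.le] at ht)
  constructor
  · rw [intervalIntegral.integral_congr (g := fun t => ⨆ x, F.θ x t) fun t ht => by
      simp only [hF, IsClassicalSolution.toFlow, hclamp t ht]]
    linarith
  · have he : β + 2 * (max 1 (2 - β) / 4) - 2 = β - p - 1 := by linarith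
    rw [he, intervalIntegral.integral_congr (g := fun t => ∫ x, F.thermalDiss p x t) fun t ht => by
      simp only [hF, MHDFlow.thermalDiss, IsClassicalSolution.toFlow, hclamp t ht]]
    have : 0 ≤ T * (1 + C) + C * C := by positivity
    linarith
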